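/- Let S be a surface properly homotopy equivalent to a graph Γ, via a proper homotopy equivalence φ : S → Γ with proper homotopy inverse ψ : Γ → S. Then the map Θ : Map(S) → Map(Γ) given by Θ([f]) = [φ∘f∘ψ] is a well-defined group homomorphism, and its image is contained in the pure mapping class group PMap(Γ). -/

import Mathlib

open Set Topology unitInterval

noncomputable section

/-- A map is proper-continuous: continuous and the preimage of every compact set is compact. -/
def ProperCont {X Y : Type*} [TopologicalSpace X] [TopologicalSpace Y] (f : X → Y) : Prop :=
  Continuous f ∧ ∀ K : Set Y, IsCompact K → IsCompact (f ⁻¹' K)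

/-- `f` and `g` are homotopic. -/
def Htpc {X Y : Type*} [TopologicalSpace X] [TopologicalSpace Y] (f g : X → Y) : Prop :=
  ∃ H : X × I → Y, Continuous H ∧ (∀ x, H (x, 0) = f x) ∧ (∀ x, H (x, 1) = g x)

/-- `f` and `g` are properly homotopic: joined by a homotopy which is itself a proper map. -/
def PHtpc {X Y : Type*} [TopologicalSpace X] [TopologicalSpace Y] (f g : X → Y) : Prop :=
  ∃ H : X × I → Y, ProperCont H ∧ (∀ x, H (x, 0) = f x) ∧ (∀ x, H (x, 1) = g x)

/-- `φ` is a proper homotopy equivalence with proper homotopy inverse `ψ`. -/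
def IsPHEPair {X Y : Type*} [TopologicalSpace X] [TopologicalSpace Y]
    (φ : X → Y) (ψ : Y → X) : Prop :=
  ProperCont φ ∧ ProperCont ψ ∧ PHtpc (ψ ∘ φ) id ∧ PHtpc (φ ∘ ψ) id

/-- `φ` is a proper homotopy equivalence (admitting some proper homotopy inverse). -/
def IsPHE {X Y : Type*} [TopologicalSpace X] [TopologicalSpace Y] (φ : X → Y) : Prop :=
  ∃ ψ : Y → X, IsPHEPair φ ψ

/-- `X` and `Y` are properly homotopy equivalent. -/
def PHEquivalent (X Y : Type*) [TopologicalSpace X] [TopologicalSpace Y] : Prop :=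
  ∃ φ : X → Y, IsPHE φ

/-- The standard Möbius band, realized as a subset of `ℝ³`. -/
def MobiusBand : Set (ℝ × ℝ × ℝ) :=
  {p | ∃ u v : ℝ, |v| ≤ 1 / 2 ∧
    p = ((1 + v * Real.cos (u / 2)) * Real.cos u,
         (1 + v * Real.cos (u / 2)) * Real.sin u,
         v * Real.sin (u / 2))}

/-- A surface: a connected, orientable (no embedded Möbius band), second-countable, Hausdorff
topological 2-manifold, possibly with boundary (locally modeled on the closed half-plane). -/
structure IsSurface (S : Type*) [TopologicalSpace S] : Prop where
  connected : ConnectedSpace S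
  t2 : T2Space S
  secondCountable : SecondCountableTopology S
  locallyHalfPlane : ∀ x : S, ∃ (U : Set S) (V : Set {p : ℝ × ℝ // 0 ≤ p.2}),
    IsOpen U ∧ x ∈ U ∧ IsOpen V ∧ Nonempty (↥U ≃ₜ ↥V)
  orientable : ¬ ∃ f : ↥MobiusBand → S, IsEmbedding f

/-- The boundary of a surface: the set of points having no open neighborhood
homeomorphic to `ℝ²`. -/
def Bd (S : Type*) [TopologicalSpace S] : Set S :=
  {x | ¬ ∃ U : Set S, IsOpen U ∧ x ∈ U ∧ Nonempty (↥U ≃ₜ (ℝ × ℝ))}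

/-- The unit circle in the plane. -/
def Circ : Set (ℝ × ℝ) := {p | p.1 ^ 2 + p.2 ^ 2 = 1}

/-- A simple closed curve in `S`: the image of a topological embedding of the circle. -/
def IsSimpleClosedCurve {S : Type*} [TopologicalSpace S] (α : Set S) : Prop :=
  ∃ f : ↥Circ → S, IsEmbedding f ∧ range f = α

/-- A boundary isolating curve: a simple closed curve `α ⊆ S ∖ ∂S` such that `S ∖ α` has
exactly two connected components `Y` and `Z` with `Y ∩ ∂S ≠ ∅`, `Z ∩ ∂S = ∅`, and
`Z ∪ α` noncompact. -/
def IsBoundaryIsolating {S : Type*} [TopologicalSpace S] (α : Set S) : Prop :=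
  IsSimpleClosedCurve α ∧ α ∩ Bd S = ∅ ∧
  ∃ Y Z : Set S, Y ≠ Z ∧
    (∀ C : Set S, (∃ x ∈ αᶜ, C = connectedComponentIn αᶜ x) ↔ (C = Y ∨ C = Z)) ∧
    (Y ∩ Bd S).Nonempty ∧ Z ∩ Bd S = ∅ ∧ ¬ IsCompact (Z ∪ α)

/-- The open part of the parametrizing interval of an edge. -/
def edgeInt : Set I := {t : I | 0 < (t : ℝ) ∧ (t : ℝ) < 1}

/-- A graph: a connected, locally finite, Hausdorff, 1-dimensional CW complex, presented by a
closed discrete vertex set and a set of characteristic maps of edges. -/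
structure IsGraph (Γ : Type*) [TopologicalSpace Γ] : Prop where
  connected : ConnectedSpace Γ
  t2 : T2Space Γ
  cell_structure : ∃ (V : Set Γ) (E : Set C(I, Γ)),
    IsClosed V ∧ DiscreteTopology ↥V ∧
    (∀ e ∈ E, e 0 ∈ V ∧ e 1 ∈ V) ∧
    (∀ e ∈ E, IsEmbedding (fun t : ↥edgeInt => e t.1)) ∧
    (∀ e ∈ E, (⇑e '' edgeInt) ∩ V = ∅) ∧
    (∀ e ∈ E, ∀ e' ∈ E, e ≠ e' → (⇑e '' edgeInt) ∩ (⇑e' '' edgeInt) = ∅) ∧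
    (V ∪ ⋃ e ∈ E, ⇑e '' edgeInt) = univ ∧
    (∀ x : Γ, ∃ U : Set Γ, IsOpen U ∧ x ∈ U ∧ {e ∈ E | (range ⇑e ∩ U).Nonempty}.Finite) ∧
    (∀ A : Set Γ, (∀ e ∈ E, IsClosed (⇑e ⁻¹' A)) → IsClosed (A ∩ ⋃ e ∈ E, range ⇑e)) ∧
    (∀ v ∈ V, (∃ e ∈ E, v ∈ range ⇑e) ∨ (univ : Set Γ) = {v})

/-- A finite graph: a graph with finitely many cells, equivalently a compact graph. -/
def IsFiniteGraph (Γ : Type*) [TopologicalSpace Γ] : Prop :=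
  IsGraph Γ ∧ CompactSpace Γ

/-- A deformation retraction of `S` onto the subspace `A`. -/
def IsDeformationRetraction {S : Type*} [TopologicalSpace S] (H : S × I → S) (A : Set S) :
    Prop :=
  Continuous H ∧ (∀ x, H (x, 0) = x) ∧ (∀ x, H (x, 1) ∈ A) ∧ (∀ a ∈ A, H (a, 1) = a)

/-- A proper deformation retraction of `S` onto the subspace `A`. -/
def IsProperDeformationRetraction {S : Type*} [TopologicalSpace S] (H : S × I → S)
    (A : Set S) : Prop :=
  ProperCont H ∧ (∀ x, H (x, 0) = x) ∧ (∀ x, H (x, 1) ∈ A) ∧ (∀ a ∈ A, H (a, 1) = a)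

/-- An end of a space, recorded as a compatible choice of a connected component of the
complement of each compact set. -/
def IsEndFn {Γ : Type*} [TopologicalSpace Γ] (s : Set Γ → Set Γ) : Prop :=
  (∀ K : Set Γ, IsCompact K → ∃ x ∈ Kᶜ, s K = connectedComponentIn Kᶜ x) ∧
  (∀ K K' : Set Γ, IsCompact K → IsCompact K' → K ⊆ K' → s K' ⊆ s K)

/-- A proper map induces the identity on the space of ends. -/
def InducesIdOnEnds {Γ : Type*} [TopologicalSpace Γ] (g : Γ → Γ) : Prop :=
  ∀ s : Set Γ → Set Γ, IsEndFn s → ∀ K : Set Γ, IsCompact K →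
    ∃ K' : Set Γ, IsCompact K' ∧ K ⊆ K' ∧ g '' s K' ⊆ s K

/-- An isotopy between `f` and `g` relative to the set `B`: a homotopy each of whose time
slices is a homeomorphism fixing `B` pointwise. -/
def IsotopicRel {S : Type*} [TopologicalSpace S] (B : Set S) (f g : S → S) : Prop :=
  ∃ H : S × I → S, Continuous H ∧ (∀ x, H (x, 0) = f x) ∧ (∀ x, H (x, 1) = g x) ∧
    ∀ t : I, IsHomeomorph (fun x => H (x, t)) ∧ ∀ x ∈ B, H (x, t) = x

/-- An isotopy between `f` and `g`: a homotopy each of whose time slices is a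
homeomorphism. -/
def Isotopic {S : Type*} [TopologicalSpace S] (f g : S → S) : Prop :=
  ∃ H : S × I → S, Continuous H ∧ (∀ x, H (x, 0) = f x) ∧ (∀ x, H (x, 1) = g x) ∧
    ∀ t : I, IsHomeomorph (fun x => H (x, t))

/-- Representatives for the mapping class group of a surface: homeomorphisms fixing the
boundary pointwise, with the compact-open topology. -/
abbrev MCGRep (S : Type*) [TopologicalSpace S] :=
  {f : C(S, S) // IsHomeomorph ⇑f ∧ ∀ x ∈ Bd S, f x = x}

/-- The isotopy-rel-boundary relation on representatives. -/
def mcgRel (S : Type*) [TopologicalSpace S] (f g : MCGRep S) : Prop :=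
  IsotopicRel (Bd S) ⇑f.1 ⇑g.1

/-- The mapping class group `Map(S)` of a surface as a topological space: homeomorphisms
fixing the boundary pointwise, modulo isotopy rel boundary, with the quotient of the
compact-open topology. -/
abbrev MCG (S : Type*) [TopologicalSpace S] := Quot (mcgRel S)

/-- Representatives for the extended mapping class group: all homeomorphisms. -/
abbrev ExRep (S : Type*) [TopologicalSpace S] := {f : C(S, S) // IsHomeomorph ⇑f}

/-- The (free) isotopy relation on representatives. -/
def exRel (S : Type*) [TopologicalSpace S] (f g : ExRep S) : Prop :=
  Isotopic ⇑f.1 ⇑g.1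

/-- The extended mapping class group `ExMap(S)` as a topological space. -/
abbrev ExMCG (S : Type*) [TopologicalSpace S] := Quot (exRel S)

/-- Representatives for the mapping class group of a graph: proper homotopy equivalences
admitting a proper homotopy inverse, with the compact-open topology. -/
abbrev GphRep (Γ : Type*) [TopologicalSpace Γ] := {g : C(Γ, Γ) // IsPHE ⇑g}

/-- The proper homotopy relation on representatives. -/
def gphRel (Γ : Type*) [TopologicalSpace Γ] (g h : GphRep Γ) : Prop :=
  PHtpc ⇑g.1 ⇑h.1

/-- The mapping class group `Map(Γ)` of a graph as a topological space. -/
abbrev GphMCG (Γ : Type*) [TopologicalSpace Γ] := Quot (gphRel Γ)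

/-- Rotation of the unit circle by angle `a`. -/
def rotC (a : ℝ) (p : ↥Circ) : ↥Circ :=
  ⟨(p.1.1 * Real.cos a - p.1.2 * Real.sin a, p.1.1 * Real.sin a + p.1.2 * Real.cos a), by
    have h : p.1.1 ^ 2 + p.1.2 ^ 2 = 1 := p.2
    have h2 := Real.sin_sq_add_cos_sq a
    simp only [Circ, Set.mem_setOf_eq]
    nlinarith [h, h2]⟩

/-- Reflection of the unit circle (the standard orientation-reversing involution). -/
def circConj (p : ↥Circ) : ↥Circ :=
  ⟨(p.1.1, -p.1.2), by
    have h : p.1.1 ^ 2 + p.1.2 ^ 2 = 1 := p.2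
    simp only [Circ, Set.mem_setOf_eq]
    nlinarith [h]⟩

/-- The midpoint of the unit interval. -/
def ihalf : I := ⟨1 / 2, by norm_num [Set.mem_Icc]⟩

/-- `f` is the twist map determined by an embedded annular collar `e`:
`e(θ,t) ↦ e(θ + 2πt, t)` on the image of `e` and the identity elsewhere. -/
def IsTwistMap {S : Type*} [TopologicalSpace S] (e : ↥Circ × I → S) (f : S → S) : Prop :=
  IsEmbedding e ∧
  (∀ (θ : ↥Circ) (t : I), f (e (θ, t)) = e (rotC (2 * Real.pi * (t : ℝ)) θ, t)) ∧
  (∀ x, x ∉ range e → f x = x)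

/-- A Dehn twist about a compact boundary component of `S`. -/
def IsCptBdTwist {S : Type*} [TopologicalSpace S] (f : S → S) : Prop :=
  ∃ e : ↥Circ × I → S, IsTwistMap e f ∧
    (∃ x ∈ Bd S, range (fun θ : ↥Circ => e (θ, 0)) = connectedComponentIn (Bd S) x ∧
      IsCompact (connectedComponentIn (Bd S) x)) ∧
    (∀ (θ : ↥Circ) (t : I), (t : ℝ) ≠ 0 → e (θ, t) ∉ Bd S)

/-- The closed unit disk in the plane. -/
def ClosedDisk : Set (ℝ × ℝ) := {p | p.1 ^ 2 + p.2 ^ 2 ≤ 1}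

/-- A Dehn twist about a degenerate boundary chain: a twist supported in an annulus disjoint
from `∂S` whose core curve cuts off a piece homeomorphic to a closed disk with a nonempty
proper closed subset removed from its boundary circle. -/
def IsDegChainTwist {S : Type*} [TopologicalSpace S] (f : S → S) : Prop :=
  ∃ e : ↥Circ × I → S, IsTwistMap e f ∧ range e ∩ Bd S = ∅ ∧
    ∃ x ∈ (range fun θ : ↥Circ => e (θ, ihalf))ᶜ,
      ∃ J : Set (ℝ × ℝ), J ⊆ Circ ∧ IsClosed J ∧ J.Nonempty ∧ J ≠ Circ ∧
        Nonempty
          (↥(closure (connectedComponentIn (range fun θ : ↥Circ => e (θ, ihalf))ᶜ x)) ≃ₜ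
            ↥(ClosedDisk \ J))

/-- `f` is a finite composition of maps satisfying the predicate `P`. -/
def IsProductOf {S : Type*} [TopologicalSpace S] (P : (S → S) → Prop) (f : S → S) : Prop :=
  ∃ L : List (S → S), (∀ g ∈ L, P g) ∧ f = L.foldr (· ∘ ·) id

/-- The closed half-strip `[0,∞) × [0,1]`. -/
def HalfStrip : Set (ℝ × ℝ) := {p | 0 ≤ p.1 ∧ 0 ≤ p.2 ∧ p.2 ≤ 1}

/-- The closed strip `ℝ × [0,1]`. -/
def FullStrip : Set (ℝ × ℝ) := {p | 0 ≤ p.2 ∧ p.2 ≤ 1}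

/-- A closed annulus in the plane. -/
def AnnulusSet : Set (ℝ × ℝ) := {p | 1 ≤ p.1 ^ 2 + p.2 ^ 2 ∧ p.1 ^ 2 + p.2 ^ 2 ≤ 4}

/-- A surface is sporadic if it is homeomorphic to the closed disk, the half-strip, the
strip, or the annulus. -/
def IsSporadic (S : Type*) [TopologicalSpace S] : Prop :=
  Nonempty (S ≃ₜ ↥ClosedDisk) ∨ Nonempty (S ≃ₜ ↥HalfStrip) ∨
    Nonempty (S ≃ₜ ↥FullStrip) ∨ Nonempty (S ≃ₜ ↥AnnulusSet)

/-- A parametrization of a compact boundary component of `S` by the circle. -/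
def IsCptBdParam {S : Type*} [TopologicalSpace S] (β : ↥Circ → S) : Prop :=
  IsEmbedding β ∧ ∃ x ∈ Bd S, range β = connectedComponentIn (Bd S) x ∧
    IsCompact (range β)

/-- A proper parametrization of a noncompact boundary component of `S` by the line. -/
def IsNcptBdParam {S : Type*} [TopologicalSpace S] (β : ℝ → S) : Prop :=
  IsEmbedding β ∧ ProperCont β ∧ ∃ x ∈ Bd S, range β = connectedComponentIn (Bd S) x ∧
    ¬ IsCompact (range β)

/-- `g` fixes (up to homotopy, resp. proper homotopy, and preserving orientations) each
curve and line of the collection `B` of `φ'`-images of boundary components: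
membership in `Map(Γ, B)`. -/
def FixesBdryImages {S : Type*} [TopologicalSpace S] (G : Set S) (φ' : S → ↥G)
    (g : ↥G → ↥G) : Prop :=
  (∀ β : ↥Circ → S, IsCptBdParam β → Htpc (g ∘ φ' ∘ β) (φ' ∘ β)) ∧
  (∀ β : ℝ → S, IsNcptBdParam β → PHtpc (g ∘ φ' ∘ β) (φ' ∘ β))

/-- `g` preserves the collection `B` of `φ'`-images of boundary components, possibly
permuting its members and reversing orientations: membership in `Map*(Γ, B)`. -/
def PermutesBdryImages {S : Type*} [TopologicalSpace S] (G : Set S) (φ' : S → ↥G)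
    (g : ↥G → ↥G) : Prop :=
  (∀ β : ↥Circ → S, IsCptBdParam β → ∃ β' : ↥Circ → S, IsCptBdParam β' ∧
    (Htpc (g ∘ φ' ∘ β) (φ' ∘ β') ∨ Htpc (g ∘ φ' ∘ β) (φ' ∘ β' ∘ circConj))) ∧
  (∀ β : ℝ → S, IsNcptBdParam β → ∃ β' : ℝ → S, IsNcptBdParam β' ∧
    (PHtpc (g ∘ φ' ∘ β) (φ' ∘ β') ∨ PHtpc (g ∘ φ' ∘ β) (φ' ∘ β' ∘ (fun r : ℝ => -r))))

end


section ProperHomotopy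

variable {X Y Z : Type*} [TopologicalSpace X] [TopologicalSpace Y] [TopologicalSpace Z]

theorem ProperCont.comp {g : Y → Z} {f : X → Y} (hg : ProperCont g) (hf : ProperCont f) :
    ProperCont (g ∘ f) :=
  ⟨hg.1.comp hf.1, fun K hK => hf.2 _ (hg.2 K hK)⟩

theorem IsHomeomorph.properCont {f : X → Y} (hf : IsHomeomorph f) : ProperCont f :=
  ⟨hf.continuous, fun _ hK => (hf.homeomorph f).isClosedEmbedding.isCompact_preimage hK⟩

theorem PHtpc.symm {f g : X → Y} (h : PHtpc f g) : PHtpc g f := by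
  obtain ⟨H, hH, h0, h1⟩ := h
  have hσ : IsHomeomorph (Prod.map id σ : X × I → X × I) :=
    ((Homeomorph.refl X).prodCongr unitInterval.symmHomeomorph).isHomeomorph
  exact ⟨H ∘ Prod.map id σ, hH.comp hσ.properCont, by simp [h1], by simp [h0]⟩

theorem PHtpc.trans {f g k : X → Y} (h : PHtpc f g) (h' : PHtpc g k) : PHtpc f k := by
  obtain ⟨H, hH, h0, h1⟩ := h
  obtain ⟨H', hH', h0', h1'⟩ := h'
  let a : X × I → X × I := fun p => (p.1, Set.projIcc 0 1 zero_le_one (2 * (p.2 : ℝ)))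
  let b : X × I → X × I := fun p => (p.1, Set.projIcc 0 1 zero_le_one (2 * (p.2 : ℝ) - 1))
  let a' : X × I → X × I := fun p => (p.1, Set.projIcc 0 1 zero_le_one ((p.2 : ℝ) / 2))
  let b' : X × I → X × I := fun p => (p.1, Set.projIcc 0 1 zero_le_one (((p.2 : ℝ) + 1) / 2))
  have ha : Continuous a := by fun_prop
  have hb : Continuous b := by fun_prop
  have ha' : Continuous a' := by fun_prop
  have hb' : Continuous b' := by fun_prop
  have haa : ∀ p : X × I, (p.2 : ℝ) ≤ 1 / 2 → a' (a p) = p := by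
    rintro ⟨x, t, ht0, ht1⟩ ht
    simp only at ht
    simp only [a, a', Prod.mk.injEq, true_and]
    rw [Set.projIcc_of_mem zero_le_one (show 2 * t ∈ Set.Icc (0 : ℝ) 1 by constructor <;> linarith),
      Set.projIcc_of_mem zero_le_one
        (show (2 * t) / 2 ∈ Set.Icc (0 : ℝ) 1 by constructor <;> linarith)]
    ext; simp
  have hbb : ∀ p : X × I, 1 / 2 ≤ (p.2 : ℝ) → b' (b p) = p := by
    rintro ⟨x, t, ht0, ht1⟩ ht
    simp only at ht
    simp only [b, b', Prod.mk.injEq, true_and]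
    rw [Set.projIcc_of_mem zero_le_one
        (show 2 * t - 1 ∈ Set.Icc (0 : ℝ) 1 by constructor <;> linarith),
      Set.projIcc_of_mem zero_le_one
        (show (2 * t - 1 + 1) / 2 ∈ Set.Icc (0 : ℝ) 1 by constructor <;> linarith)]
    ext; simp
  have haa' : ∀ p : X × I, a (a' p) = p := by
    rintro ⟨x, t, ht0, ht1⟩
    simp only [a, a', Prod.mk.injEq, true_and]
    rw [Set.projIcc_of_mem zero_le_one (show t / 2 ∈ Set.Icc (0 : ℝ) 1 by constructor <;> linarith),
      Set.projIcc_of_mem zero_le_one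
        (show 2 * (t / 2) ∈ Set.Icc (0 : ℝ) 1 by constructor <;> linarith)]
    ext; simp; ring
  have hbb' : ∀ p : X × I, b (b' p) = p := by
    rintro ⟨x, t, ht0, ht1⟩
    simp only [b, b', Prod.mk.injEq, true_and]
    rw [Set.projIcc_of_mem zero_le_one
        (show (t + 1) / 2 ∈ Set.Icc (0 : ℝ) 1 by constructor <;> linarith),
      Set.projIcc_of_mem zero_le_one
        (show 2 * ((t + 1) / 2) - 1 ∈ Set.Icc (0 : ℝ) 1 by constructor <;> linarith)]
    ext; simp; ring
  have hab : ∀ p : X × I, (p.2 : ℝ) = 1 / 2 → H (a p) = H' (b p) := by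
    rintro ⟨x, t⟩ ht
    simp only at ht
    have e1 : a (x, t) = (x, 1) := by
      simp only [a, Prod.mk.injEq, true_and]; rw [ht]; norm_num
    have e2 : b (x, t) = (x, 0) := by
      simp only [b, Prod.mk.injEq, true_and]; rw [ht]; norm_num
    rw [e1, e2, h1, h0']
  let G : X × I → Y := fun p => if (p.2 : ℝ) ≤ 1 / 2 then H (a p) else H' (b p)
  have hG : Continuous G := by
    refine Continuous.if_le (hH.1.comp ha) (hH'.1.comp hb) (by fun_prop) (by fun_prop) hab
  have hGb : ∀ p : X × I, 1 / 2 = (p.2 : ℝ) → G p = H' (b p) := fun p hp => by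
    rw [← hab p hp.symm]; exact if_pos hp.ge
  refine ⟨G, ⟨hG, fun K hK => ?_⟩, fun x => ?_, fun x => ?_⟩
  · have hs : IsClosed {p : X × I | (p.2 : ℝ) ≤ 1 / 2} := isClosed_le (by fun_prop) (by fun_prop)
    have hs' : IsClosed {p : X × I | 1 / 2 ≤ (p.2 : ℝ)} := isClosed_le (by fun_prop) (by fun_prop)
    have c1 := ((hH.2 K hK).image ha').inter_right hs
    have c2 := ((hH'.2 K hK).image hb').inter_right hs'
    convert c1.union c2 using 1
    ext p
    simp only [mem_preimage, mem_union, mem_inter_iff, mem_image, mem_ofPred_eq]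
    constructor
    · intro hp
      by_cases ht : (p.2 : ℝ) ≤ 1 / 2
      · left
        simp only [G, if_pos ht] at hp
        exact ⟨⟨a p, hp, haa p ht⟩, ht⟩
      · right
        simp only [G, if_neg ht] at hp
        exact ⟨⟨b p, hp, hbb p (by linarith)⟩, by linarith⟩
    · rintro (⟨⟨q, hq, rfl⟩, ht⟩ | ⟨⟨q, hq, rfl⟩, ht⟩)
      · simp only [G, if_pos ht, haa' q]
        exact hq
      · have hq' : H' (b (b' q)) ∈ K := by rw [hbb']; exact hq
        rcases ht.lt_or_eq with h | h
        · simp only [G, if_neg (not_le.2 h)]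
          exact hq'
        · have e := hGb (b' q) h
          rw [e]; exact hq'
  · simp [G, a, h0]
  · have : ¬ (1 : ℝ) ≤ 2⁻¹ := by norm_num
    simp [G, b, this]
    norm_num [h1']

end ProperHomotopy

section ProperHomotopyComposition

variable {X Y Z : Type*} [TopologicalSpace X] [TopologicalSpace Y] [TopologicalSpace Z]

theorem PHtpc.comp_left {f f' : X → Y} (h : PHtpc f f') {g : Y → Z} (hg : ProperCont g) :
    PHtpc (g ∘ f) (g ∘ f') := by
  obtain ⟨H, hH, h0, h1⟩ := h
  exact ⟨g ∘ H, hg.comp hH, by simp [h0], by simp [h1]⟩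

theorem ProperCont.prodMap_id [T2Space X] {g : Z → X} (hg : ProperCont g) :
    ProperCont (Prod.map g id : Z × I → X × I) := by
  have hc : Continuous (Prod.map g id : Z × I → X × I) := hg.1.prodMap continuous_id
  refine ⟨hc, fun K hK => ?_⟩
  refine ((hg.2 _ (hK.image continuous_fst)).prod isCompact_univ).of_isClosed_subset
    (hK.isClosed.preimage hc) ?_
  rintro ⟨z, t⟩ hz
  exact ⟨⟨_, hz, rfl⟩, mem_univ _⟩

theorem PHtpc.comp_right [T2Space X] {f f' : X → Y} (h : PHtpc f f') {g : Z → X}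
    (hg : ProperCont g) : PHtpc (f ∘ g) (f' ∘ g) := by
  obtain ⟨H, hH, h0, h1⟩ := h
  exact ⟨H ∘ Prod.map g id, hH.comp hg.prodMap_id, by simp [h0], by simp [h1]⟩

end ProperHomotopyComposition

section Isotopy

variable {X : Type*} [TopologicalSpace X]

/-- In a locally compact, locally connected Hausdorff space, the inverses of a continuous family
of homeomorphisms form a continuous family, so that the family is a proper map. -/
theorem properCont_of_isotopy [T2Space X] [LocallyCompactSpace X] [LocallyConnectedSpace X]
    {H : X × I → X} (hH : Continuous H) (hiso : ∀ t, IsHomeomorph fun x => H (x, t)) :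
    ProperCont H := by
  let G : X × I → X × I := fun p => (H p, p.2)
  have hG : Continuous G := by fun_prop
  have hbij : Function.Bijective G := by
    constructor
    · rintro ⟨x, t⟩ ⟨y, s⟩ h
      obtain ⟨h1, rfl⟩ := Prod.mk.inj h
      exact Prod.ext ((hiso t).injective h1) rfl
    · rintro ⟨y, t⟩
      obtain ⟨x, hx⟩ := (hiso t).surjective y
      exact ⟨(x, t), Prod.ext hx rfl⟩
  have hopen : IsOpenMap G := by
    rw [IsOpenMap.eq_1]
    refine fun O hO => isOpen_iff_mem_nhds.2 ?_
    rintro _ ⟨⟨x₀, t₀⟩, hmem, rfl⟩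
    obtain ⟨A, hA, J, hJ, hAJ⟩ := mem_nhds_prod_iff.1 (hO.mem_nhds hmem)
    obtain ⟨C, hC, hCA, hCc⟩ := local_compact_nhds hA
    set U := interior C
    have hUC : U ⊆ C := interior_subset
    have hUo : IsOpen U := isOpen_interior
    have hx₀ : x₀ ∈ U := mem_interior_iff_mem_nhds.2 hC
    have hBc : IsCompact (C \ U) := hCc.diff hUo
    have himg : IsOpen ((fun x => H (x, t₀)) '' U) := (hiso t₀).isOpenMap _ hUo
    obtain ⟨W', hW', hW'sub, hW'c⟩ :=
      local_compact_nhds (himg.mem_nhds ⟨x₀, hx₀, rfl⟩)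
    obtain ⟨W, hWsub, hWo, hxW, hWconn⟩ := locallyConnectedSpace_iff_subsets_isOpen_isConnected.1
      ‹_› (H (x₀, t₀)) W' hW'
    have hW'cl : IsOpen (W'ᶜ) := hW'c.isClosed.isOpen_compl
    have hB : ∀ᶠ t in 𝓝 t₀, ∀ x ∈ C \ U, H (x, t) ∈ W'ᶜ := by
      refine hBc.eventually_forall_of_forall_eventually fun x hx => ?_
      have : H (x, t₀) ∈ W'ᶜ := by
        intro hw
        obtain ⟨y, hy, hyx⟩ := hW'sub hw
        exact hx.2 ((hiso t₀).injective hyx ▸ hy)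
      have h2 : ∀ᶠ q : X × I in 𝓝 (x, t₀), H q ∈ W'ᶜ :=
        hH.continuousAt.eventually (hW'cl.mem_nhds this)
      have h3 : Filter.Tendsto (fun z : I × X => (z.2, z.1)) (𝓝 (t₀, x)) (𝓝 (x, t₀)) :=
        (continuous_swap (X := I) (Y := X)).tendsto (t₀, x)
      exact h3.eventually h2
    have hx : ∀ᶠ t in 𝓝 t₀, H (x₀, t) ∈ W :=
      (hH.comp (by fun_prop : Continuous fun t : I => (x₀, t))).continuousAt.eventually
        (hWo.mem_nhds hxW)
    have hgood : W ×ˢ {t | t ∈ J ∧ (∀ x ∈ C \ U, H (x, t) ∈ W'ᶜ) ∧ H (x₀, t) ∈ W} ∈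
        𝓝 (G (x₀, t₀)) :=
      prod_mem_nhds (hWo.mem_nhds hxW) (Filter.inter_mem hJ (Filter.inter_mem hB hx))
    refine Filter.mem_of_superset hgood ?_
    rintro ⟨y, t⟩ ⟨hy, htJ, htB, htx⟩
    have hsub : W ⊆ (fun x => H (x, t)) '' U := by
      refine hWconn.isPreconnected.subset_left_of_subset_union ((hiso t).isOpenMap _ hUo)
        ((hiso t).isOpenMap Cᶜ hCc.isClosed.isOpen_compl) ?_ ?_ ⟨_, htx, x₀, hx₀, rfl⟩
      · exact (Set.disjoint_image_iff (hiso t).injective).2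
          (disjoint_compl_right.mono_left hUC)
      · intro w hw
        obtain ⟨x, rfl⟩ := (hiso t).surjective w
        by_cases h1 : x ∈ U
        · exact Or.inl ⟨x, h1, rfl⟩
        · by_cases h2 : x ∈ C
          · exact absurd (hWsub hw) (htB x ⟨h2, h1⟩)
          · exact Or.inr ⟨x, h2, rfl⟩
    obtain ⟨x, hxU, rfl⟩ := hsub hy
    exact ⟨(x, t), hAJ ⟨hCA (hUC hxU), htJ⟩, rfl⟩
  have hGhom : IsHomeomorph G := ⟨hG, hopen, hbij⟩
  refine ⟨hH, fun K hK => ?_⟩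
  have := hGhom.properCont.2 _ (hK.prod isCompact_univ (X := X) (Y := I))
  convert this using 1
  ext p
  simp [G]

end Isotopy

section Surfaces

variable {S : Type*} [TopologicalSpace S]

theorem halfPlane_convex : Convex ℝ {p : ℝ × ℝ | 0 ≤ p.2} :=
  convex_halfSpace_ge (f := Prod.snd) (LinearMap.snd ℝ ℝ ℝ).isLinear 0

theorem halfPlane_isClosed : IsClosed {p : ℝ × ℝ | 0 ≤ p.2} :=
  isClosed_le continuous_const continuous_snd

theorem IsSurface.exists_chart (hS : IsSurface S) (x : S) :
    ∃ (V : Set {p : ℝ × ℝ // 0 ≤ p.2}) (j : V → S), IsOpen V ∧ IsOpenEmbedding j ∧ x ∈ range j := by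
  obtain ⟨U, V, hU, hx, hV, ⟨e⟩⟩ := hS.locallyHalfPlane x
  refine ⟨V, fun v => e.symm v, hV, hU.isOpenEmbedding_subtypeVal.comp e.symm.isOpenEmbedding,
    ⟨e ⟨x, hx⟩, by simp⟩⟩

theorem IsSurface.locallyCompactSpace (hS : IsSurface S) : LocallyCompactSpace S := by
  have := hS.t2
  have : LocallyCompactSpace {p : ℝ × ℝ // 0 ≤ p.2} :=
    halfPlane_isClosed.isClosedEmbedding_subtypeVal.locallyCompactSpace
  have : WeaklyLocallyCompactSpace S := ⟨fun x => by
    obtain ⟨V, j, hV, hj, v, rfl⟩ := hS.exists_chart x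
    have := hV.locallyCompactSpace
    obtain ⟨C, hC, hCv⟩ := exists_compact_mem_nhds v
    exact ⟨j '' C, hC.image hj.continuous, hj.isOpenMap.image_mem_nhds hCv⟩⟩
  infer_instance

theorem IsSurface.locallyConnectedSpace (hS : IsSurface S) : LocallyConnectedSpace S := by
  have : LocallyPathConnectedSpace {p : ℝ × ℝ // 0 ≤ p.2} :=
    halfPlane_convex.locallyPathConnectedSpace
  have hbase : ∀ x : S, ∀ O ∈ 𝓝 x, ∃ V ∈ 𝓝 x, IsPreconnected V ∧ V ⊆ O := by
    intro x O hO
    obtain ⟨V, j, hV, hj, v, rfl⟩ := hS.exists_chart x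
    have := hV.locallyPathConnectedSpace
    obtain ⟨W, hW, hWO⟩ := (LocallyPathConnectedSpace.path_connected_basis v).mem_iff.1
      (hj.continuous.continuousAt hO)
    exact ⟨j '' W, hj.isOpenMap.image_mem_nhds hW.1,
      (hW.2.isConnected.isPreconnected.image _ hj.continuous.continuousOn),
      image_subset_iff.2 hWO⟩
  refine locallyConnectedSpace_iff_connected_subsets.2 hbase

end Surfaces

section LogOrder

theorem even_of_sq_eq_zpow_mul_exp {b : ℂ} {ρ : ℝ} (hρ : 0 < ρ) {n : ℤ} {l τ : ℂ → ℂ}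
    (hl : ContinuousOn l (Metric.sphere b ρ)) (hτ : ContinuousOn τ (Metric.sphere b ρ))
    (h : ∀ w ∈ Metric.sphere b ρ, τ w ^ 2 = (w - b) ^ n * Complex.exp (l w)) : Even n := by
  set c : ℝ → ℂ := fun θ => circleMap b ρ θ with hc
  have hcm : ∀ θ, c θ ∈ Metric.sphere b ρ := fun θ => circleMap_mem_sphere b hρ.le θ
  have hcc : Continuous c := continuous_circleMap b ρ
  have hlc : Continuous fun θ => l (c θ) := hl.comp_continuous hcc hcm
  have hτc : Continuous fun θ => τ (c θ) := hτ.comp_continuous hcc hcm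
  set q : ℝ → ℂ := fun θ => τ (c θ) / (Complex.exp (l (c θ) / 2) *
    Complex.exp (n * (θ * Complex.I) / 2)) with hq
  have hqc : Continuous q := by
    refine hτc.div ?_ fun θ => ?_
    · have : Continuous fun θ => Complex.exp (l (c θ) / 2) :=
        Complex.continuous_exp.comp (hlc.div_const 2)
      exact this.mul (by fun_prop)
    exact mul_ne_zero (Complex.exp_ne_zero _) (Complex.exp_ne_zero _)
  have hsq : ∀ θ, q θ ^ 2 = (ρ : ℂ) ^ n := by
    intro θ
    have e1 : Complex.exp (l (c θ) / 2) ^ 2 = Complex.exp (l (c θ)) := by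
      rw [← Complex.exp_nat_mul]; congr 1; push_cast; ring
    have e2 : Complex.exp (n * (θ * Complex.I) / 2) ^ 2 = Complex.exp (θ * Complex.I) ^ n := by
      rw [← Complex.exp_nat_mul, ← Complex.exp_int_mul]; congr 1; push_cast; ring
    have e3 : c θ - b = ρ * Complex.exp (θ * Complex.I) := by simp [hc, circleMap]
    simp only [hq]
    rw [div_pow, mul_pow, e1, e2, h _ (hcm θ), e3, mul_zpow]
    have := zpow_ne_zero n (Complex.exp_ne_zero (θ * Complex.I))
    field_simp
  have hρn : (ρ : ℂ) ^ n ≠ 0 := zpow_ne_zero n (by exact_mod_cast hρ.ne')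
  have hq0 : ∀ θ, q θ ≠ 0 := fun θ h0 => hρn (by rw [← hsq θ, h0]; simp)
  have hconst : ∀ θ, q θ = q 0 := by
    have := isPreconnected_univ.eq_or_eq_neg_of_sq_eq (f := q) (g := fun _ => q 0)
      hqc.continuousOn continuousOn_const (fun θ _ => by simp [hsq]) (fun _ => hq0 0)
    rcases this with h1 | h1
    · exact fun θ => h1 (mem_univ θ)
    · have := h1 (mem_univ 0)
      simp only [Pi.neg_apply] at this
      exact absurd (self_eq_neg.1 this) (hq0 0)
  have hp : c (2 * Real.pi) = c 0 := by
    have := periodic_circleMap b ρ 0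
    simpa [hc] using this
  have h2 := hconst (2 * Real.pi)
  have hne : τ (c 0) ≠ 0 := fun h0 => hq0 0 (by simp [hq, h0])
  simp only [hq, hp] at h2
  have h3 : Complex.exp (n * (Real.pi * Complex.I)) = 1 := by
    have e : (n * ((2 * Real.pi : ℝ) * Complex.I) / 2 : ℂ) = n * (Real.pi * Complex.I) := by
      push_cast; ring
    rw [e] at h2
    have := Complex.exp_ne_zero (l (c 0) / 2)
    have := Complex.exp_ne_zero (n * (Real.pi * Complex.I))
    simp only [Complex.ofReal_zero, zero_mul, mul_zero, zero_div, Complex.exp_zero] at h2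
    field_simp at h2
    rw [← mul_assoc]
    exact h2.symm
  obtain ⟨k, hk⟩ := Complex.exp_eq_one_iff.1 h3
  refine ⟨k, ?_⟩
  have hpi : (Real.pi * Complex.I : ℂ) ≠ 0 :=
    mul_ne_zero (Complex.ofReal_ne_zero.2 Real.pi_ne_zero) Complex.I_ne_zero
  have : (n : ℂ) = k + k := by
    apply mul_right_cancel₀ hpi
    rw [hk]; ring
  exact_mod_cast this

/-- Near `b`, the function `g` is `(w - b) ^ n` times the exponential of a continuous function. -/
def HasLogOrder (g : ℂ → ℂ) (b : ℂ) (n : ℤ) : Prop :=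
  ∃ r > 0, ∃ l : ℂ → ℂ, ContinuousOn l (Metric.ball b r \ {b}) ∧
    ∀ w ∈ Metric.ball b r \ {b}, g w = (w - b) ^ n * Complex.exp (l w)

theorem HasLogOrder.congr {g g' : ℂ → ℂ} {b : ℂ} {n : ℤ} (h : HasLogOrder g b n) {r : ℝ}
    (hr : 0 < r) (hg : ∀ w ∈ Metric.ball b r \ {b}, g w = g' w) : HasLogOrder g' b n := by
  obtain ⟨r', hr', l, hl, hgl⟩ := h
  have hs : Metric.ball b (min r r') \ {b} ⊆ Metric.ball b r' \ {b} :=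
    sdiff_subset_sdiff_left (Metric.ball_subset_ball (min_le_right _ _))
  have hs' : Metric.ball b (min r r') \ {b} ⊆ Metric.ball b r \ {b} :=
    sdiff_subset_sdiff_left (Metric.ball_subset_ball (min_le_left _ _))
  exact ⟨min r r', lt_min hr hr', l, hl.mono hs, fun w hw => by
    rw [← hg w (hs' hw), hgl w (hs hw)]⟩

theorem HasLogOrder.div {g g' : ℂ → ℂ} {b : ℂ} {n n' : ℤ} (h : HasLogOrder g b n)
    (h' : HasLogOrder g' b n') : HasLogOrder (fun w => g w / g' w) b (n - n') := by
  obtain ⟨r, hr, l, hl, hgl⟩ := h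
  obtain ⟨r', hr', l', hl', hgl'⟩ := h'
  have hs : Metric.ball b (min r r') \ {b} ⊆ Metric.ball b r' \ {b} :=
    sdiff_subset_sdiff_left (Metric.ball_subset_ball (min_le_right _ _))
  have hs' : Metric.ball b (min r r') \ {b} ⊆ Metric.ball b r \ {b} :=
    sdiff_subset_sdiff_left (Metric.ball_subset_ball (min_le_left _ _))
  refine ⟨min r r', lt_min hr hr', fun w => l w - l' w, (hl.mono hs').sub (hl'.mono hs),
    fun w hw => ?_⟩
  have hw0 : w - b ≠ 0 := sub_ne_zero.2 hw.2
  simp only [hgl w (hs' hw), hgl' w (hs hw)]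
  rw [zpow_sub₀ hw0, Complex.exp_sub]
  field_simp

theorem exists_hasLogOrder {g : ℂ → ℂ} {b : ℂ} {r : ℝ} (hr : 0 < r)
    (hg : ContinuousOn g (Metric.ball b r \ {b})) (h0 : ∀ w ∈ Metric.ball b r \ {b}, g w ≠ 0) :
    ∃ n, HasLogOrder g b n := by
  set U : Set ℂ := {ζ | ζ.re < Real.log r} with hU
  have hUo : IsOpen U := isOpen_lt Complex.continuous_re continuous_const
  have hUconv : Convex ℝ U := convex_halfSpace_re_lt _
  have hUne : U.Nonempty := ⟨((Real.log r - 1 : ℝ) : ℂ), by simp [hU]⟩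
  have hUsc : IsSimplyConnected U := by
    have := hUconv.contractibleSpace hUne
    exact SimplyConnectedSpace.ofContractible U
  have hUmem : ∀ ζ, ζ ∈ U ↔ b + Complex.exp ζ ∈ Metric.ball b r \ {b} := by
    intro ζ
    simp only [hU, mem_ofPred_eq, mem_sdiff, Metric.mem_ball, dist_self_add_left, Complex.norm_exp,
      mem_singleton_iff, add_eq_left, Complex.exp_ne_zero, not_false_eq_true, and_true]
    exact Real.lt_log_iff_exp_lt hr
  have hGc : ContinuousOn (fun ζ => g (b + Complex.exp ζ)) U :=
    hg.comp (by fun_prop) fun ζ hζ => (hUmem ζ).1 hζ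
  obtain ⟨L, hLc, hL⟩ := Complex.exists_continuousOn_eqOn_exp_comp
    hUsc hUo hGc (by
      rintro ⟨ζ, hζ, hz⟩
      exact h0 _ ((hUmem ζ).1 hζ) hz)
  have hL' : ∀ ζ ∈ U, Complex.exp (L ζ) = g (b + Complex.exp ζ) := fun ζ hζ => hL hζ
  set p : ℂ := 2 * Real.pi * Complex.I with hp
  have hp0 : p ≠ 0 := Complex.two_pi_I_ne_zero
  have hpU : ∀ ζ ∈ U, ζ + p ∈ U := by
    intro ζ hζ
    simpa [hU, hp] using hζ
  have hshift : ∀ ζ ∈ U, ∃ k : ℤ, L (ζ + p) = L ζ + k * p := by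
    intro ζ hζ
    have : Complex.exp (L (ζ + p)) = Complex.exp (L ζ) := by
      rw [hL' _ hζ, hL' _ (hpU ζ hζ), hp, Complex.exp_periodic]
    exact Complex.exp_eq_exp_iff_exists_int.1 this
  obtain ⟨ζ₀, hζ₀⟩ := hUne
  obtain ⟨n, hn⟩ := hshift ζ₀ hζ₀
  have hn' : ∀ ζ ∈ U, L (ζ + p) = L ζ + n * p := by
    intro ζ hζ
    have hc : ContinuousOn (fun ζ => (L (ζ + p) - L ζ) / p) U :=
      ((hLc.comp (by fun_prop) hpU).sub hLc).div_const _
    have hdisc : IsDiscrete (range (Int.cast : ℤ → ℂ)) :=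
      ⟨Complex.isClosedEmbedding_intCast.toIsEmbedding.toHomeomorph.symm.isEmbedding.discreteTopology⟩
    have := hUconv.isPreconnected.constant_of_mapsTo hdisc hc (by
      intro ξ hξ
      obtain ⟨k, hk⟩ := hshift ξ hξ
      refine ⟨k, ?_⟩
      simp only [hk]; field_simp; try ring) hζ hζ₀
    simp only [hn] at this
    field_simp at this
    linear_combination this
  set N : ℂ → ℂ := fun ζ => L ζ - n * ζ with hN
  have hNc : ContinuousOn N U := hLc.sub (by fun_prop)
  have hNp : ∀ k : ℤ, ∀ ζ ∈ U, N (ζ + k * p) = N ζ := by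
    have hpU' : ∀ k : ℤ, ∀ ζ ∈ U, ζ + k * p ∈ U := by
      intro k ζ hζ
      simpa [hU, hp] using hζ
    have h1 : ∀ ζ ∈ U, N (ζ + p) = N ζ := by
      intro ζ hζ
      simp only [hN, hn' ζ hζ]; ring
    intro k ζ hζ
    induction k using Int.induction_on with
    | zero => simp
    | succ i ih =>
      rw [← ih, ← h1 _ (hpU' i ζ hζ)]; congr 1; push_cast; ring
    | pred i ih =>
      rw [← ih, ← h1 _ (hpU' (-i - 1) ζ hζ)]; congr 1; push_cast; ring
  refine ⟨n, r, hr, fun w => N (Complex.log (w - b)), ?_, ?_⟩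
  · intro w₀ hw₀
    have hne : w₀ - b ≠ 0 := sub_ne_zero.2 hw₀.2
    set ℓ : ℂ → ℂ := fun w => Complex.log ((w - b) / (w₀ - b)) + Complex.log (w₀ - b) with hℓ
    have hℓe : ∀ w, w - b ≠ 0 → Complex.exp (ℓ w) = w - b := by
      intro w hw
      simp only [hℓ]
      rw [Complex.exp_add, Complex.exp_log (div_ne_zero hw hne), Complex.exp_log hne]
      field_simp
    have hℓc : ContinuousAt ℓ w₀ := by
      refine ContinuousAt.add (ContinuousAt.clog (by fun_prop) ?_) continuousAt_const
      simp [div_self hne]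
    have hℓU : ∀ w ∈ Metric.ball b r \ {b}, ℓ w ∈ U := by
      intro w hw
      rw [hUmem, hℓe w (sub_ne_zero.2 hw.2)]
      simpa using hw
    have heq : ∀ w ∈ Metric.ball b r \ {b}, N (Complex.log (w - b)) = N (ℓ w) := by
      intro w hw
      have hw0 := sub_ne_zero.2 hw.2
      have : Complex.exp (Complex.log (w - b)) = Complex.exp (ℓ w) := by
        rw [hℓe w hw0, Complex.exp_log hw0]
      obtain ⟨k, hk⟩ := Complex.exp_eq_exp_iff_exists_int.1 this
      rw [hk]
      exact hNp k _ (hℓU w hw)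
    refine ContinuousWithinAt.congr ?_ heq (heq w₀ hw₀)
    exact (((hNc _ (hℓU w₀ hw₀)).continuousAt (hUo.mem_nhds (hℓU w₀ hw₀))).comp
      hℓc).continuousWithinAt
  · intro w hw
    have hw0 := sub_ne_zero.2 hw.2
    have hlU : Complex.log (w - b) ∈ U := by
      rw [hUmem, Complex.exp_log hw0]; simpa using hw
    have := hL' _ hlU
    rw [Complex.exp_log hw0, add_sub_cancel] at this
    rw [← this]
    simp only [hN]
    rw [Complex.exp_sub, Complex.exp_int_mul, Complex.exp_log hw0]
    have := zpow_ne_zero n hw0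
    field_simp

end LogOrder

section GlobalLog

theorem hasLogOrder_zpow_sub {b b' : ℂ} (h : b' ≠ b) (n : ℤ) :
    HasLogOrder (fun w => (w - b) ^ n) b' 0 := by
  have hb : b' - b ≠ 0 := sub_ne_zero.2 h
  have key : ∀ w ∈ Metric.ball b' ‖b' - b‖, (w - b) / (b' - b) ∈ Complex.slitPlane := by
    intro w hw
    have e : (w - b) / (b' - b) = 1 + (w - b') / (b' - b) := by field_simp; ring
    rw [e]
    apply Complex.mem_slitPlane_of_norm_lt_one
    rw [norm_div, div_lt_one (norm_pos_iff.2 hb)]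
    simpa [dist_eq_norm] using hw
  refine ⟨‖b' - b‖, norm_pos_iff.2 hb,
    fun w => n * (Complex.log ((w - b) / (b' - b)) + Complex.log (b' - b)), ?_, ?_⟩
  · refine ContinuousOn.mul continuousOn_const (ContinuousOn.add ?_ continuousOn_const)
    exact ContinuousOn.clog (by fun_prop) fun w hw => key w hw.1
  · intro w hw
    have hw0 : w - b ≠ 0 := fun h0 => by
      have := Complex.slitPlane_ne_zero (key w hw.1)
      simp [h0] at this
    rw [Complex.exp_int_mul, Complex.exp_add, Complex.exp_log (div_ne_zero hw0 hb),
      Complex.exp_log hb, zpow_zero, one_mul]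
    field_simp

theorem exists_log_of_hasLogOrder (m : ℂ → ℤ) (B : Finset ℂ) : ∀ g : ℂ → ℂ,
    ContinuousOn g (B : Set ℂ)ᶜ → (∀ w ∉ B, g w ≠ 0) → (∀ b ∈ B, HasLogOrder g b (m b)) →
    ∃ R > 0, ∃ l : ℂ → ℂ, ContinuousOn l {w | R ≤ ‖w‖} ∧
      ∀ w, R ≤ ‖w‖ → g w = w ^ (∑ b ∈ B, m b) * Complex.exp (l w) := by
  induction B using Finset.induction_on with
  | empty =>
    intro g hg h0 _
    have : ContractibleSpace (univ : Set ℂ) := convex_univ.contractibleSpace univ_nonempty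
    obtain ⟨l, hl, hgl⟩ := Complex.exists_continuousOn_eqOn_exp_comp
      (SimplyConnectedSpace.ofContractible (univ : Set ℂ)) isOpen_univ (g := g)
      (by simpa using hg) (by rintro ⟨w, -, hw⟩; exact h0 w (by simp) hw)
    refine ⟨1, one_pos, l, hl.mono (subset_univ _), fun w _ => ?_⟩
    simpa using (hgl (mem_univ w)).symm
  | insert b B hbB ih =>
    intro g hg h0 hord
    obtain ⟨r₁, hr₁, l, hl, hgl⟩ := hord b (Finset.mem_insert_self b B)
    obtain ⟨r₂, hr₂, hBr⟩ := Metric.isOpen_iff.1 (B.finite_toSet.isClosed.isOpen_compl) b hbB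
    set n := m b with hn
    obtain ⟨r, hr, hrr₁, hrr₂⟩ : ∃ r > 0, r ≤ r₁ ∧ r ≤ r₂ :=
      ⟨min r₁ r₂, lt_min hr₁ hr₂, min_le_left _ _, min_le_right _ _⟩
    replace hBr : ∀ w ∈ Metric.ball b r, w ∉ B := fun w hw =>
      hBr (Metric.ball_subset_ball hrr₂ hw)
    have hsub : Metric.ball b r \ {b} ⊆ Metric.ball b r₁ \ {b} :=
      sdiff_subset_sdiff_left (Metric.ball_subset_ball hrr₁)
    replace hl := hl.mono hsub
    replace hgl : ∀ w ∈ Metric.ball b r \ {b}, g w = (w - b) ^ n * Complex.exp (l w) :=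
      fun w hw => hgl w (hsub hw)
    set χ : ℂ → ℝ := fun w => min 1 (max 0 (4 * dist w b / r - 1)) with hχ
    have hχc : Continuous χ := by fun_prop
    have hχ0 : ∀ w, dist w b < r / 4 → χ w = 0 := by
      intro w hw
      have : 4 * dist w b / r - 1 ≤ 0 := by
        rw [sub_nonpos, div_le_one hr]; linarith
      simp [hχ, max_eq_left this]
    have hχ1 : ∀ w, r / 2 < dist w b → χ w = 1 := by
      intro w hw
      have : 1 ≤ 4 * dist w b / r - 1 := by
        rw [le_sub_iff_add_le, le_div_iff₀ hr]; linarith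
      simp only [hχ]
      exact min_eq_left (le_max_of_le_right this)
    set k : ℂ → ℂ := fun w => if dist w b < r then Complex.exp (χ w * l w) else
      g w / (w - b) ^ n with hk
    have hkfar : ∀ w, r / 2 < dist w b → k w = g w / (w - b) ^ n := by
      intro w hw
      have hwb : w ≠ b := by rintro rfl; rw [dist_self] at hw; linarith
      by_cases h : dist w b < r
      · simp only [hk, if_pos h, hχ1 w hw, hgl w ⟨h, hwb⟩]
        have := zpow_ne_zero n (sub_ne_zero.2 hwb)
        rw [Complex.ofReal_one, one_mul]
        field_simp
      · simp only [hk, if_neg h]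
    have hopen : IsOpen {w | r / 2 < dist w b} := isOpen_lt continuous_const (by fun_prop)
    have hkc : ContinuousOn k (B : Set ℂ)ᶜ := by
      intro w hw
      by_cases h1 : dist w b < r / 4
      · have : k =ᶠ[𝓝 w] fun _ => 1 := by
          filter_upwards [(isOpen_lt (by fun_prop) continuous_const).mem_nhds
            (show w ∈ {w | dist w b < r / 4} from h1)] with v hv
          change dist v b < r / 4 at hv
          simp [hk, hχ0 v hv, show dist v b < r by linarith]
        exact (continuousAt_const.congr this.symm).continuousWithinAt
      by_cases h2 : dist w b < r
      · have hwb : w ≠ b := by rintro rfl; rw [dist_self] at h1; apply h1; linarith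
        have hO : IsOpen (Metric.ball b r \ {b}) := Metric.isOpen_ball.sdiff isClosed_singleton
        have hwO : w ∈ Metric.ball b r \ {b} := ⟨h2, hwb⟩
        have : k =ᶠ[𝓝 w] fun w => Complex.exp (χ w * l w) := by
          filter_upwards [hO.mem_nhds hwO] with v hv
          simp [hk, Metric.mem_ball.1 hv.1]
        refine (ContinuousAt.congr ?_ this.symm).continuousWithinAt
        have := hl.continuousAt (hO.mem_nhds hwO)
        exact ((Complex.continuous_ofReal.comp hχc).continuousAt.mul this).cexp
      · have hw2 : r / 2 < dist w b := by linarith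
        have hwb : w ≠ b := by rintro rfl; rw [dist_self] at h1; apply h1; linarith
        have : k =ᶠ[𝓝 w] fun w => g w / (w - b) ^ n := by
          filter_upwards [hopen.mem_nhds hw2] with v hv using hkfar v hv
        refine (ContinuousAt.congr ?_ this.symm).continuousWithinAt
        have hgw : ContinuousAt g w := hg.continuousAt
          ((insert b B).finite_toSet.isClosed.isOpen_compl.mem_nhds (by
            simpa [hwb] using hw))
        refine hgw.div (ContinuousAt.zpow₀ (by fun_prop) n (Or.inl (sub_ne_zero.2 hwb))) ?_
        exact zpow_ne_zero _ (sub_ne_zero.2 hwb)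
    have hk0 : ∀ w ∉ B, k w ≠ 0 := by
      intro w hw
      by_cases h : dist w b < r
      · simp [hk, if_pos h]
      · have hwb : w ≠ b := by rintro rfl; rw [dist_self] at h; exact h hr
        simp only [hk, if_neg h]
        exact div_ne_zero (h0 w (by simp [hwb, hw])) (zpow_ne_zero _ (sub_ne_zero.2 hwb))
    have hkord : ∀ b' ∈ B, HasLogOrder k b' (m b') := by
      intro b' hb'
      have hne : b' ≠ b := fun h => hbB (h ▸ hb')
      have hd : r ≤ dist b' b := not_lt.1 fun h => hBr b' h hb'
      have := (hord b' (Finset.mem_insert_of_mem hb')).div (hasLogOrder_zpow_sub hne n)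
      rw [sub_zero] at this
      refine this.congr (r := r / 2) (by linarith) fun w hw => (hkfar w ?_).symm
      have h1 := Metric.mem_ball.1 hw.1
      have := dist_triangle_left b' b w
      linarith
    obtain ⟨R, hR, l', hl', hkl⟩ := ih k hkc hk0 hkord
    have hbig : ∀ w, max R (‖b‖ + r) ≤ ‖w‖ → w ≠ 0 ∧ 1 - b / w ∈ Complex.slitPlane ∧
        r / 2 < dist w b := by
      intro w hw
      have h1 := (le_max_right _ _).trans hw
      have hw0 : 0 < ‖w‖ := by have := norm_nonneg b; linarith
      refine ⟨norm_pos_iff.1 hw0, ?_, ?_⟩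
      · rw [sub_eq_add_neg]
        apply Complex.mem_slitPlane_of_norm_lt_one
        rw [norm_neg, norm_div, div_lt_one hw0]; linarith
      · rw [dist_eq_norm]
        have := norm_sub_norm_le w b
        linarith
    refine ⟨max R (‖b‖ + r), lt_max_of_lt_left hR,
      fun w => l' w + n * Complex.log (1 - b / w), ?_, ?_⟩
    · refine ContinuousOn.add (hl'.mono fun w hw => (le_max_left R _).trans (mem_ofPred_eq ▸ hw)) ?_
      refine ContinuousOn.mul continuousOn_const (ContinuousOn.clog ?_ fun w hw => (hbig w hw).2.1)
      exact continuousOn_const.sub (continuousOn_const.div continuousOn_id fun w hw => (hbig w hw).1)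
    · intro w hw
      obtain ⟨hw0, hs, hd⟩ := hbig w hw
      have hwb : w - b ≠ 0 := by
        intro h
        rw [dist_eq_norm, h, norm_zero] at hd; linarith
      have e1 := hkl w ((le_max_left _ _).trans hw)
      rw [hkfar w hd, div_eq_iff (zpow_ne_zero n hwb)] at e1
      rw [e1, Finset.sum_insert hbB, zpow_add₀ hw0, Complex.exp_add, Complex.exp_int_mul,
        Complex.exp_log (Complex.slitPlane_ne_zero hs)]
      have : (w - b) ^ n = w ^ n * (1 - b / w) ^ n := by
        rw [← mul_zpow]; congr 1; field_simp
      rw [this, ← hn]; ring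

theorem even_sum_of_hasLogOrder {m : ℂ → ℤ} {B : Finset ℂ} {g : ℂ → ℂ} {C : Set ℂ}
    (hC : IsCompact C) (hg1 : ∀ w ∉ C, g w = 1) (hg : ContinuousOn g (B : Set ℂ)ᶜ)
    (h0 : ∀ w ∉ B, g w ≠ 0) (hord : ∀ b ∈ B, HasLogOrder g b (m b)) : Even (∑ b ∈ B, m b) := by
  obtain ⟨R, hR, l, hl, hgl⟩ := exists_log_of_hasLogOrder m B g hg h0 hord
  obtain ⟨R', hR'⟩ := hC.isBounded.subset_ball 0
  set ρ := max R R' with hρ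
  have hm : ∀ w ∈ Metric.sphere (0 : ℂ) ρ, ‖w‖ = ρ := fun w hw => by simpa using hw
  refine even_of_sq_eq_zpow_mul_exp (b := 0) (ρ := ρ) (l := l) (τ := fun _ => 1)
    (lt_max_of_lt_left hR) (hl.mono fun w hw => ?_) continuousOn_const fun w hw => ?_
  · exact (le_max_left R R').trans (hm w hw).ge
  · rw [sub_zero, ← hgl w ((le_max_left R R').trans (hm w hw).ge), hg1 w fun hwC => ?_, one_pow]
    have h1 := hR' hwC
    rw [Metric.mem_ball, dist_zero_right, hm w hw] at h1
    exact absurd h1 (not_lt.2 (le_max_right _ _))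

end GlobalLog

section ParityOfZeros

variable {M : Type*} [TopologicalSpace M]

/-- Near `x`, away from `x` itself, the function `z` has a continuous square root. -/
def EvenAt (z : M → ℂ) (x : M) : Prop :=
  ∃ W ∈ 𝓝 x, ∃ τ : M → ℂ, ContinuousOn τ (W \ {x}) ∧ ∀ y ∈ W \ {x}, τ y ^ 2 = z y

/-- The points of `A` around which `z` has no continuous square root. -/
def oddPts (z : M → ℂ) (A : Set M) : Set M := {x ∈ A | ¬ EvenAt z x}

theorem EvenAt.congr {z z' : M → ℂ} {x : M} (h : EvenAt z x) (hz : z =ᶠ[𝓝 x] z') :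
    EvenAt z' x := by
  obtain ⟨W, hW, τ, hτ, hsq⟩ := h
  refine ⟨W ∩ {y | z y = z' y}, Filter.inter_mem hW hz, τ, hτ.mono ?_, fun y hy => ?_⟩
  · exact sdiff_subset_sdiff_left inter_subset_left
  · rw [hsq y ⟨hy.1.1, hy.2⟩]; exact hy.1.2

theorem evenAt_congr {z z' : M → ℂ} {x : M} (hz : z =ᶠ[𝓝 x] z') : EvenAt z x ↔ EvenAt z' x :=
  ⟨fun h => h.congr hz, fun h => h.congr hz.symm⟩

theorem evenAt_of_ne_zero {z : M → ℂ} (hz : Continuous z) {x : M} (hx : z x ≠ 0) :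
    EvenAt z x := by
  have hs : ∀ᶠ y in 𝓝 x, z y / z x ∈ Complex.slitPlane := by
    refine (hz.div_const (z x)).continuousAt.eventually (Complex.isOpen_slitPlane.mem_nhds ?_)
    simp [div_self hx]
  refine ⟨_, hs, fun y => Complex.exp ((Complex.log (z y / z x) + Complex.log (z x)) / 2),
    ?_, ?_⟩
  · refine ContinuousOn.cexp (ContinuousOn.div_const (ContinuousOn.add ?_ continuousOn_const) 2)
    exact ContinuousOn.clog (hz.div_const _).continuousOn fun y hy => hy.1
  · intro y hy
    have h1 : z y / z x ≠ 0 := Complex.slitPlane_ne_zero hy.1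
    rw [← Complex.exp_nat_mul, Nat.cast_ofNat, mul_div_cancel₀ _ (two_ne_zero), Complex.exp_add,
      Complex.exp_log h1, Complex.exp_log hx, div_mul_cancel₀ _ hx]

theorem oddPts_subset_zeros {z : M → ℂ} (hz : Continuous z) (A : Set M) :
    oddPts z A ⊆ {x ∈ A | z x = 0} :=
  fun _ hx => ⟨hx.1, by_contra fun h => hx.2 (evenAt_of_ne_zero hz h)⟩

theorem evenAt_comp_iff {N : Type*} [TopologicalSpace N] {j : N → M} (hj : IsOpenEmbedding j)
    (z : M → ℂ) (w : N) : EvenAt (z ∘ j) w ↔ EvenAt z (j w) := by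
  constructor
  · rintro ⟨W, hW, τ, hτ, hsq⟩
    have : Nonempty N := ⟨w⟩
    have hinv : ∀ v, Function.invFun j (j v) = v := Function.leftInverse_invFun hj.injective
    refine ⟨j '' W, hj.isOpenMap.image_mem_nhds hW, τ ∘ Function.invFun j, ?_, ?_⟩
    · rintro _ ⟨⟨v, hv, rfl⟩, hne⟩
      have hvw : v ∈ W \ {w} := ⟨hv, fun h => hne (congrArg j h)⟩
      have h1 : Filter.Tendsto (Function.invFun j) (𝓝[j '' W \ {j w}] (j v)) (𝓝[W \ {w}] v) := by
        have : j '' W \ {j w} = j '' (W \ {w}) := by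
          rw [image_sdiff hj.injective, image_singleton]
        rw [this, ← hj.isEmbedding.map_nhdsWithin_eq, Filter.tendsto_map'_iff]
        exact Filter.tendsto_id.congr fun u => (hinv u).symm
      change Filter.Tendsto _ _ (𝓝 (τ (Function.invFun j (j v))))
      rw [hinv]
      exact Filter.Tendsto.comp (hτ v hvw) h1
    · rintro _ ⟨⟨v, hv, rfl⟩, hne⟩
      simpa [hinv] using hsq v ⟨hv, fun h => hne (congrArg j h)⟩
  · rintro ⟨W, hW, τ, hτ, hsq⟩
    have hmaps : MapsTo j (j ⁻¹' W \ {w}) (W \ {j w}) := fun v hv =>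
      ⟨hv.1, fun h => hv.2 (hj.injective h)⟩
    exact ⟨j ⁻¹' W, hj.continuous.continuousAt hW, τ ∘ j,
      hτ.comp hj.continuous.continuousOn hmaps, fun v hv => hsq _ (hmaps hv)⟩

theorem HasLogOrder.evenAt_iff {f : ℂ → ℂ} {b : ℂ} {n : ℤ} (h : HasLogOrder f b n) :
    EvenAt f b ↔ Even n := by
  obtain ⟨r, hr, l, hl, hfl⟩ := h
  constructor
  · rintro ⟨W, hW, τ, hτ, hsq⟩
    obtain ⟨r', hr', hW'⟩ := Metric.mem_nhds_iff.1 hW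
    obtain ⟨ρ, hρ, hρr⟩ := exists_between (lt_min hr hr')
    have hs : ∀ w ∈ Metric.sphere b ρ, w ≠ b := by
      rintro w hw rfl
      rw [Metric.mem_sphere, dist_self] at hw; exact hρ.ne hw
    have hs1 : ∀ w ∈ Metric.sphere b ρ, w ∈ Metric.ball b r \ {b} := fun w hw =>
      ⟨by rw [Metric.mem_ball, Metric.mem_sphere.1 hw]; exact hρr.trans_le (min_le_left _ _),
        hs w hw⟩
    have hs2 : ∀ w ∈ Metric.sphere b ρ, w ∈ W \ {b} := fun w hw =>
      ⟨hW' (by rw [Metric.mem_ball, Metric.mem_sphere.1 hw]; exact hρr.trans_le (min_le_right _ _)),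
        hs w hw⟩
    exact even_of_sq_eq_zpow_mul_exp hρ (hl.mono hs1) (hτ.mono hs2) fun w hw => by
      rw [hsq w (hs2 w hw), hfl w (hs1 w hw)]
  · rintro ⟨k, rfl⟩
    refine ⟨_, Metric.ball_mem_nhds b hr, fun w => (w - b) ^ k * Complex.exp (l w / 2), ?_, ?_⟩
    · refine ContinuousOn.mul (ContinuousOn.zpow₀ (by fun_prop) k fun w hw =>
        Or.inl (sub_ne_zero.2 hw.2)) (hl.div_const 2).cexp
    · intro w hw
      have hw0 : w - b ≠ 0 := sub_ne_zero.2 hw.2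
      rw [hfl w hw, mul_pow, ← Complex.exp_nat_mul, zpow_add₀ hw0, Nat.cast_ofNat,
        mul_div_cancel₀ _ (two_ne_zero)]
      ring

theorem Finset.cast_sum_eq_card_odd {ι : Type*} (B : Finset ι) (n : ι → ℤ) {C : Set ι}
    (hC : ∀ b, b ∈ C ↔ b ∈ B ∧ ¬ Even (n b)) : ((∑ b ∈ B, n b : ℤ) : ZMod 2) = C.ncard := by
  classical
  have : C = (B.filter fun b => ¬ Even (n b) : Finset ι) := by
    ext b; simp [hC]
  rw [this, Set.ncard_coe_finset, Finset.card_filter, Int.cast_sum, Nat.cast_sum]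
  refine Finset.sum_congr rfl fun b _ => ?_
  by_cases h : Even (n b)
  · simpa [h] using (ZMod.intCast_zmod_eq_zero_iff_dvd (n b) 2).2 h.two_dvd
  · rw [if_pos h]
    obtain ⟨k, hk⟩ := Int.not_even_iff_odd.1 h
    rw [hk]; push_cast
    rw [show (2 : ZMod 2) = 0 from rfl]; simp

theorem div_mem_slitPlane {u v : ℂ} (h : (0 : ℂ) ∉ segment ℝ u v) : v / u ∈ Complex.slitPlane := by
  have hu : u ≠ 0 := fun h0 => h (h0 ▸ left_mem_segment ℝ u v)
  by_contra hns
  rw [Complex.mem_slitPlane_iff, not_or, not_lt, not_not] at hns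
  obtain ⟨hre, him⟩ := hns
  have e : v / u = ((v / u).re : ℂ) := by
    apply Complex.ext <;> simp [him]
  rw [div_eq_iff hu] at e
  apply h
  set t := (v / u).re with ht
  have h1 : 0 < 1 - t := by linarith
  refine ⟨-t / (1 - t), 1 / (1 - t), div_nonneg (by linarith) h1.le, by positivity, by
    field_simp; ring, ?_⟩
  rw [e]
  have : (1 - t : ℂ) ≠ 0 := by exact_mod_cast h1.ne'
  simp only [Complex.real_smul]
  push_cast
  field_simp
  ring

theorem planar_parity {O : Set ℂ} (hO : IsOpen O) {f f' : ℂ → ℂ} (hf : Continuous f)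
    (hf' : Continuous f') (hZ : {w ∈ O | f w = 0}.Finite) (hZ' : {w ∈ O | f' w = 0}.Finite)
    (hT : IsCompact {w ∈ O | (0 : ℂ) ∈ segment ℝ (f w) (f' w)}) :
    ((oddPts f O).ncard : ZMod 2) = (oddPts f' O).ncard := by
  classical
  set T := {w ∈ O | (0 : ℂ) ∈ segment ℝ (f w) (f' w)} with hTdef
  have hTO : T ⊆ O := fun w hw => hw.1
  have hfT : ∀ w ∈ O, w ∉ T → f w ≠ 0 := fun w hw hwT h =>
    hwT ⟨hw, h ▸ left_mem_segment ℝ _ _⟩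
  have hf'T : ∀ w ∈ O, w ∉ T → f' w ≠ 0 := fun w hw hwT h =>
    hwT ⟨hw, h ▸ right_mem_segment ℝ _ _⟩
  obtain ⟨K, hK, hTK, hKO⟩ := exists_compact_between hT hO hTO
  obtain ⟨ρ, hρ1, hρc, hρO⟩ : ∃ ρ : ℂ → ℝ, (∀ w ∈ K, ρ w = 1) ∧ Continuous ρ ∧
      (HasCompactSupport ρ ∧ tsupport ρ ⊆ O) := by
    obtain ⟨ρ, h1, hs, hsO, -⟩ := exists_continuousMap_one_of_isCompact_subset_isOpen hK hO hKO
    exact ⟨ρ, h1, ρ.continuous, hs, hsO⟩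
  obtain ⟨hρs, hρO⟩ := hρO
  set B := hZ.toFinset ∪ hZ'.toFinset with hB
  have hBmem : ∀ w, w ∈ B ↔ w ∈ O ∧ (f w = 0 ∨ f' w = 0) := by
    intro w; simp [hB, ← and_or_left]
  have hord : ∀ h : ℂ → ℂ, Continuous h → {w ∈ O | h w = 0}.Finite → ∀ b ∈ B,
      ∃ n, HasLogOrder h b n := by
    intro h hc hfin b hb
    have hbO := ((hBmem b).1 hb).1
    have hopen : IsOpen (O \ ({w ∈ O | h w = 0} \ {b})) :=
      hO.sdiff (hfin.subset sdiff_subset).isClosed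
    obtain ⟨r, hr, hball⟩ := Metric.isOpen_iff.1 hopen b ⟨hbO, fun hb => hb.2 rfl⟩
    exact exists_hasLogOrder hr hc.continuousOn fun w hw h0 =>
      (hball hw.1).2 ⟨⟨(hball hw.1).1, h0⟩, hw.2⟩
  choose! n hn using hord f hf hZ
  choose! n' hn' using hord f' hf' hZ'
  set g : ℂ → ℂ := fun w => if w ∈ T then f' w / f w else
    Complex.exp (ρ w * Complex.log (f' w / f w)) with hg
  have hgK : ∀ w ∈ K, g w = f' w / f w := by
    intro w hw
    by_cases hwT : w ∈ T
    · simp [hg, hwT]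
    · simp only [hg, if_neg hwT, hρ1 w hw, Complex.ofReal_one, one_mul]
      exact Complex.exp_log (div_ne_zero (hf'T w (hKO hw) hwT) (hfT w (hKO hw) hwT))
  have hTρ : T ⊆ tsupport ρ := fun w hw => subset_tsupport _ (by
    rw [Function.mem_support, hρ1 w (interior_subset (hTK hw))]; exact one_ne_zero)
  have hg1 : ∀ w ∉ tsupport ρ, g w = 1 := by
    intro w hw
    have hwT : w ∉ T := fun h => hw (hTρ h)
    simp [hg, hwT, image_eq_zero_of_notMem_tsupport hw]
  have hBT : ∀ w ∈ B, w ∈ T := by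
    intro w hw
    obtain ⟨hwO, h | h⟩ := (hBmem w).1 hw
    · exact by_contra fun h' => hfT w hwO h' h
    · exact by_contra fun h' => hf'T w hwO h' h
  have hgc : ContinuousOn g (B : Set ℂ)ᶜ := by
    intro w hw
    apply ContinuousAt.continuousWithinAt
    by_cases hwT : w ∈ T
    · have hev : g =ᶠ[𝓝 w] fun w => f' w / f w := by
        filter_upwards [isOpen_interior.mem_nhds (hTK hwT)] with v hv using
          hgK v (interior_subset hv)
      refine ContinuousAt.congr ?_ hev.symm
      refine hf'.continuousAt.div hf.continuousAt fun h => hw ?_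
      exact (hBmem w).2 ⟨hTO hwT, Or.inl h⟩
    by_cases hwO : w ∈ O
    · have hev : g =ᶠ[𝓝 w] fun w => Complex.exp (ρ w * Complex.log (f' w / f w)) := by
        filter_upwards [hT.isClosed.isOpen_compl.mem_nhds hwT] with v hv
        simp only [hg]
        exact if_neg hv
      refine ContinuousAt.congr ?_ hev.symm
      refine ((Complex.continuous_ofReal.comp hρc).continuousAt.mul ?_).cexp
      refine ContinuousAt.clog (hf'.continuousAt.div hf.continuousAt (hfT w hwO hwT)) ?_
      exact div_mem_slitPlane fun h => hwT ⟨hwO, h⟩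
    · have hev : g =ᶠ[𝓝 w] fun _ => 1 := by
        filter_upwards [(isClosed_tsupport ρ).isOpen_compl.mem_nhds fun h => hwO (hρO h)]
          with v hv using hg1 v hv
      exact continuousAt_const.congr hev.symm
  have hg0 : ∀ w ∉ B, g w ≠ 0 := by
    intro w hw
    by_cases hwT : w ∈ T
    · simp only [hg, if_pos hwT]
      rw [hBmem, not_and, not_or] at hw
      obtain ⟨h1, h2⟩ := hw (hTO hwT)
      exact div_ne_zero h2 h1
    · simp only [hg, if_neg hwT]
      exact Complex.exp_ne_zero _
  have hsum := even_sum_of_hasLogOrder hρs.isCompact hg1 hgc hg0 (m := fun b => n' b - n b)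
    (by
      intro b hb
      obtain ⟨r, hr, hball⟩ := Metric.isOpen_iff.1 (isOpen_interior (s := K)) b (hTK (hBT b hb))
      exact ((hn' b hb).div (hn b hb)).congr hr fun w hw =>
        (hgK w (interior_subset (hball hw.1))).symm)
  have hcard : ((∑ b ∈ B, n b : ℤ) : ZMod 2) = (oddPts f O).ncard := by
    refine B.cast_sum_eq_card_odd n fun b => ⟨fun hb => ?_, fun hb => ?_⟩
    · have hbB : b ∈ B := (hBmem b).2 ⟨hb.1, Or.inl (oddPts_subset_zeros hf O hb).2⟩
      exact ⟨hbB, (hn b hbB).evenAt_iff.not.1 hb.2⟩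
    · exact ⟨((hBmem b).1 hb.1).1, (hn b hb.1).evenAt_iff.not.2 hb.2⟩
  have hcard' : ((∑ b ∈ B, n' b : ℤ) : ZMod 2) = (oddPts f' O).ncard := by
    refine B.cast_sum_eq_card_odd n' fun b => ⟨fun hb => ?_, fun hb => ?_⟩
    · have hbB : b ∈ B := (hBmem b).2 ⟨hb.1, Or.inr (oddPts_subset_zeros hf' O hb).2⟩
      exact ⟨hbB, (hn' b hbB).evenAt_iff.not.1 hb.2⟩
    · exact ⟨((hBmem b).1 hb.1).1, (hn' b hb.1).evenAt_iff.not.2 hb.2⟩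
  have h2 := (ZMod.intCast_zmod_eq_zero_iff_dvd _ 2).2 hsum.two_dvd
  rw [← hcard, ← hcard', eq_comm, ← sub_eq_zero, ← h2, Finset.sum_sub_distrib, Int.cast_sub]

end ParityOfZeros

section Charts

variable {M : Type*} [TopologicalSpace M]

theorem zero_mem_segment_iff_norm {u v : ℂ} : (0 : ℂ) ∈ segment ℝ u v ↔ ‖u‖ + ‖v‖ = ‖u - v‖ := by
  rw [mem_segment_iff_wbtw, ← dist_add_dist_eq_iff, dist_zero_right, dist_zero_left, dist_eq_norm]

theorem isClosed_zero_mem_segment {z z' : M → ℂ} (hz : Continuous z) (hz' : Continuous z') :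
    IsClosed {x | (0 : ℂ) ∈ segment ℝ (z x) (z' x)} := by
  simp only [zero_mem_segment_iff_norm]
  exact isClosed_eq (by fun_prop) (by fun_prop)

theorem chart_parity [T2Space M] {j : ℂ → M} (hj : IsOpenEmbedding j) {A C : Set M}
    (hA : IsOpen A) {D : Set ℂ} (hD : IsCompact D) (hC : C = j '' D) {z z' : M → ℂ}
    (hz : Continuous z) (hz' : Continuous z') (hzz' : ∀ x ∉ C, z' x = z x)
    (hZ : {x ∈ A | z x = 0}.Finite) (hZ' : {x ∈ A | z' x = 0}.Finite)
    (hT : IsCompact {x ∈ A | x ∈ C ∧ (0 : ℂ) ∈ segment ℝ (z x) (z' x)}) :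
    ((oddPts z A).ncard : ZMod 2) = (oddPts z' A).ncard := by
  have hfin : ∀ {y : M → ℂ}, {x ∈ A | y x = 0}.Finite → {w ∈ j ⁻¹' A | (y ∘ j) w = 0}.Finite :=
    fun {y} h => h.preimage (f := j) hj.injective.injOn
  have hTc : IsCompact {w ∈ j ⁻¹' A | (0 : ℂ) ∈ segment ℝ ((z ∘ j) w) ((z' ∘ j) w)} := by
    have h1 : IsCompact (j ⁻¹' {x ∈ A | x ∈ C ∧ (0 : ℂ) ∈ segment ℝ (z x) (z' x)}) :=
      hj.isInducing.isCompact_preimage' hT fun x hx => by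
        have := hx.2.1
        rw [hC] at this
        exact image_subset_range j D this
    have hfinset : {w ∈ j ⁻¹' A | (z ∘ j) w = 0 ∧ j w ∉ C}.Finite :=
      (hfin hZ).subset fun w hw => ⟨hw.1, hw.2.1⟩
    convert h1.union hfinset.isCompact using 1
    ext w
    simp only [mem_ofPred_eq, mem_union, mem_preimage, Function.comp_apply]
    constructor
    · rintro ⟨h1, h2⟩
      by_cases h : j w ∈ C
      · exact Or.inl ⟨h1, h, h2⟩
      · rw [hzz' _ h, segment_same] at h2
        exact Or.inr ⟨h1, h2.symm, h⟩
    · rintro (⟨h1, -, h2⟩ | ⟨h1, h2, h3⟩)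
      · exact ⟨h1, h2⟩
      · exact ⟨h1, h2 ▸ left_mem_segment ℝ _ _⟩
  have hpar := planar_parity (hA.preimage hj.continuous) (hz.comp hj.continuous)
    (hz'.comp hj.continuous) (hfin hZ) (hfin hZ') hTc
  have hcount : ∀ y : M → ℂ, Continuous y → {x ∈ A | y x = 0}.Finite →
      (oddPts y A).ncard = (oddPts (y ∘ j) (j ⁻¹' A)).ncard + (oddPts y (A \ range j)).ncard := by
    intro y hy hfy
    have e1 : (oddPts (y ∘ j) (j ⁻¹' A)).ncard = (oddPts y (A ∩ range j)).ncard := by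
      rw [← ncard_image_of_injective _ hj.injective]
      congr 1
      ext x
      constructor
      · rintro ⟨w, hw, rfl⟩
        exact ⟨⟨hw.1, w, rfl⟩, (evenAt_comp_iff hj y w).not.1 hw.2⟩
      · rintro ⟨⟨h1, w, rfl⟩, h2⟩
        exact ⟨w, ⟨h1, (evenAt_comp_iff hj y w).not.2 h2⟩, rfl⟩
    have hf : (oddPts y A).Finite := hfy.subset (oddPts_subset_zeros hy A)
    have hdisj : Disjoint (oddPts y (A ∩ range j)) (oddPts y (A \ range j)) := by
      rw [Set.disjoint_left]
      rintro x ⟨⟨-, h⟩, -⟩ ⟨⟨-, h'⟩, -⟩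
      exact h' h
    rw [e1, ← ncard_union_eq hdisj (hf.subset fun x hx => ⟨hx.1.1, hx.2⟩)
      (hf.subset fun x hx => ⟨hx.1.1, hx.2⟩)]
    congr 1
    ext x
    simp only [oddPts, mem_ofPred_eq, mem_union, mem_inter_iff, mem_sdiff]
    tauto
  have hoff : oddPts z (A \ range j) = oddPts z' (A \ range j) := by
    have hCc : IsClosed C := hC ▸ (hD.image hj.continuous).isClosed
    ext x
    refine and_congr_right fun hx => not_congr (evenAt_congr ?_)
    have hxC : x ∉ C := fun h => hx.2 (image_subset_range j D (hC ▸ h))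
    filter_upwards [hCc.isOpen_compl.mem_nhds hxC] with y hy using (hzz' y hy).symm
  rw [hcount z hz hZ, hcount z' hz' hZ', hoff]
  push_cast
  rw [hpar]

theorem exists_extend_zero [T2Space M] {E : Type*} [TopologicalSpace E] [Zero E] {j : ℂ → M}
    (hj : IsOpenEmbedding j) {D : Set ℂ} (hD : IsCompact D) {h : ℂ → E} (hc : Continuous h)
    (h0 : ∀ w ∉ D, h w = 0) :
    ∃ k : M → E, Continuous k ∧ (∀ w, k (j w) = h w) ∧ ∀ x ∉ j '' D, k x = 0 := by
  have hk : ∀ w, Function.extend j h 0 (j w) = h w := fun w => hj.injective.extend_apply h 0 w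
  have hk0 : ∀ x ∉ j '' D, Function.extend j h 0 x = 0 := by
    intro x hx
    by_cases hr : x ∈ range j
    · obtain ⟨w, rfl⟩ := hr
      rw [hk, h0 w fun hw => hx ⟨w, hw, rfl⟩]
    · rw [Function.extend_apply' _ _ _ hr]; rfl
  refine ⟨Function.extend j h 0, continuous_iff_continuousAt.2 fun x => ?_, hk, hk0⟩
  by_cases hx : x ∈ range j
  · obtain ⟨w, rfl⟩ := hx
    rw [← hj.continuousAt_iff]
    have : Function.extend j h 0 ∘ j = h := funext hk
    rw [this]; exact hc.continuousAt
  · have hx' : x ∉ j '' D := fun h => hx (image_subset_range j D h)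
    have : Function.extend j h 0 =ᶠ[𝓝 x] fun _ => 0 := by
      filter_upwards [(hD.image hj.continuous).isClosed.isOpen_compl.mem_nhds hx'] with y hy
        using hk0 y hy
    exact continuousAt_const.congr this.symm

theorem exists_approx_finite_zeros {f : ℂ → ℂ} (hf : Continuous f) {ε : ℝ} (hε : 0 < ε) :
    ∃ q : ℂ → ℂ, Continuous q ∧ (∀ w, ‖q w - f w‖ < ε) ∧
      ∀ D : Set ℂ, IsCompact D → {w ∈ D | q w = 0}.Finite := by
  obtain ⟨p, hp, hpf, -⟩ := hf.exists_contDiff_approx 1 (ε := fun _ => ε / 2) continuous_const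
    fun _ => by positivity
  have hd : Differentiable ℝ p := hp.differentiable (by simp)
  set s : Set ℂ := {w | (fderiv ℝ p w).det = 0} with hs
  have hnull := MeasureTheory.addHaar_image_eq_zero_of_det_fderivWithin_eq_zero
    (MeasureTheory.volume : MeasureTheory.Measure ℂ) (s := s) (f := p) (f' := fderiv ℝ p)
    (fun w _ => (hd w).hasFDerivAt.hasFDerivWithinAt) fun w hw => hw
  obtain ⟨v, hv, hvs⟩ : ∃ v ∈ Metric.ball (0 : ℂ) (ε / 2), v ∉ p '' s := by
    by_contra! h
    have h1 : Metric.ball (0 : ℂ) (ε / 2) ⊆ p '' s := h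
    have h2 := MeasureTheory.measure_mono_null h1 hnull
    exact (Metric.measure_ball_pos MeasureTheory.volume (0 : ℂ) (half_pos hε)).ne' h2
  refine ⟨fun w => p w - v, hp.continuous.sub continuous_const, fun w => ?_, fun D hD => ?_⟩
  · have h1 := hpf w
    rw [dist_eq_norm] at h1
    have h2 : ‖v‖ < ε / 2 := by simpa using hv
    calc ‖p w - v - f w‖ = ‖(p w - f w) - v‖ := by ring_nf
      _ ≤ ‖p w - f w‖ + ‖v‖ := norm_sub_le _ _
      _ < ε := by linarith
  · by_contra hinf
    obtain ⟨x, -, hx⟩ := Set.Infinite.exists_accPt_of_subset_isCompact hinf hD fun w hw => hw.1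
    have hxv : p x = v := by
      have hcl : IsClosed {w | p w = v} := isClosed_eq hp.continuous continuous_const
      have : x ∈ closure {w | p w = v} := by
        refine closure_mono ?_ hx.clusterPt.mem_closure
        exact fun w hw => sub_eq_zero.1 hw.2
      rwa [hcl.closure_eq] at this
    have hdet : (fderiv ℝ p x).det ≠ 0 := fun h => hvs ⟨x, h, hxv⟩
    have hanti : ∃ K, AntilipschitzWith K (fderiv ℝ p x) := by
      have := ((fderiv ℝ p x).toContinuousLinearEquivOfDetNeZero hdet).antilipschitz
      exact ⟨_, this⟩
    have hne := (hd x).hasFDerivAt.eventually_ne (c := v) hanti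
    obtain ⟨w, hw, hwv⟩ := ((accPt_iff_frequently_nhdsNE.1 hx).and_eventually hne).exists
    exact hwv (sub_eq_zero.1 hw.2)

theorem exists_perturb_finite_zeros [T2Space M] {j : ℂ → M} (hj : IsOpenEmbedding j) {A : Set M}
    (hA : IsClosed A) {z : M → ℂ} (hz : Continuous z)
    (hZ : {x ∈ A | x ∉ j '' Metric.closedBall 0 3 ∧ z x = 0}.Finite) {ε : ℝ} (hε : 0 < ε) :
    ∃ z' : M → ℂ, Continuous z' ∧ (∀ x, ‖z' x - z x‖ ≤ ε) ∧
      (∀ x ∉ j '' Metric.closedBall 0 4, z' x = z x) ∧ {x ∈ A | z' x = 0}.Finite := by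
  have hmemD : ∀ {w : ℂ} {r : ℝ}, j w ∈ j '' Metric.closedBall 0 r ↔ ‖w‖ ≤ r := by
    intro w r
    rw [hj.injective.mem_set_image, mem_closedBall_zero_iff]
  obtain ⟨r, r', h3r, hrr', hr4, hrfree⟩ : ∃ r r' : ℝ, 3 < r ∧ r < r' ∧ r' < 4 ∧
      ∀ w, j w ∈ A → z (j w) = 0 → ¬ (r ≤ ‖w‖ ∧ ‖w‖ ≤ r') := by
    set N : Set ℝ := norm '' (j ⁻¹' {x ∈ A | x ∉ j '' Metric.closedBall 0 3 ∧ z x = 0})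
    have hN : N.Finite := (hZ.preimage hj.injective.injOn).image _
    obtain ⟨r, hr, hrN⟩ := ((Ioo_infinite (show (3 : ℝ) < 4 by norm_num)).sdiff hN).nonempty
    obtain ⟨e, he, hball⟩ := Metric.isOpen_iff.1 (isOpen_Ioo.sdiff hN.isClosed) r ⟨hr, hrN⟩
    have hmem : ∀ y, r ≤ y → y ≤ r + e / 2 → y ∈ Ioo (3 : ℝ) 4 \ N := fun y h1 h2 => hball (by
      rw [Metric.mem_ball, Real.dist_eq, abs_of_nonneg] <;> linarith)
    refine ⟨r, r + e / 2, hr.1, by linarith, (hmem _ (by linarith) le_rfl).1.2, ?_⟩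
    rintro w hwA hw0 ⟨h1, h2⟩
    refine (hmem _ h1 h2).2 ⟨w, ⟨hwA, ?_, hw0⟩, rfl⟩
    rw [hmemD]; have := hr.1; linarith
  obtain ⟨c, hc, hcf⟩ : ∃ c > 0, ∀ w, j w ∈ A → r ≤ ‖w‖ → ‖w‖ ≤ r' → c ≤ ‖z (j w)‖ := by
    have hK : IsCompact ({w : ℂ | j w ∈ A ∧ r ≤ ‖w‖ ∧ ‖w‖ ≤ r'}) := by
      refine (isCompact_closedBall (0 : ℂ) r').of_isClosed_subset ?_ fun w hw => by simpa using hw.2.2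
      exact (hA.preimage hj.continuous).inter ((isClosed_le continuous_const continuous_norm).inter
        (isClosed_le continuous_norm continuous_const))
    obtain ⟨c, hc, h⟩ := hK.exists_forall_le' (f := fun w => ‖z (j w)‖) (a := 0)
      (hz.comp hj.continuous).norm.continuousOn fun w hw =>
        norm_pos_iff.2 fun h => hrfree w hw.1 h hw.2
    exact ⟨c, hc, fun w h1 h2 h3 => h w ⟨h1, h2, h3⟩⟩
  obtain ⟨q, hq, hqf, hqfin⟩ := exists_approx_finite_zeros (hz.comp hj.continuous)
    (lt_min hε hc)
  set χ : ℂ → ℝ := fun w => max 0 (min 1 ((r' - ‖w‖) / (r' - r))) with hχ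
  have hd : 0 < r' - r := by linarith
  have hχ1 : ∀ w, ‖w‖ ≤ r → χ w = 1 := by
    intro w hw
    have : 1 ≤ (r' - ‖w‖) / (r' - r) := by rw [le_div_iff₀ hd]; linarith
    simp [hχ, min_eq_left this]
  have hχ0 : ∀ w, r' ≤ ‖w‖ → χ w = 0 := by
    intro w hw
    have : (r' - ‖w‖) / (r' - r) ≤ 0 := div_nonpos_of_nonpos_of_nonneg (by linarith) hd.le
    simp only [hχ]
    exact max_eq_left ((min_le_right _ _).trans this)
  have hχm : ∀ w, 0 ≤ χ w ∧ χ w ≤ 1 := fun w =>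
    ⟨le_max_left _ _, max_le zero_le_one (min_le_left _ _)⟩
  obtain ⟨k, hk, hkj, hk0⟩ := exists_extend_zero hj (isCompact_closedBall (0 : ℂ) r')
    (h := fun w => (χ w : ℂ) * (q w - z (j w)))
    (by
      have : Continuous χ := by fun_prop
      have := hz.comp hj.continuous
      exact (Complex.continuous_ofReal.comp ‹Continuous χ›).mul (hq.sub this))
    fun w hw => by
      rw [mem_closedBall_zero_iff, not_le] at hw
      simp [hχ0 w hw.le]
  have hkn : ∀ w, ‖k (j w)‖ < min ε c := by
    intro w
    rw [hkj, norm_mul, Complex.norm_real, Real.norm_of_nonneg (hχm w).1]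
    have h1 := hqf w
    have h2 := (hχm w).2
    have h3 := norm_nonneg (q w - z (j w))
    simp only [Function.comp_apply] at h1
    nlinarith
  refine ⟨fun x => z x + k x, hz.add hk, fun x => ?_, fun x hx => ?_, ?_⟩
  · rw [add_sub_cancel_left]
    by_cases hx : x ∈ j '' Metric.closedBall 0 r'
    · obtain ⟨w, -, rfl⟩ := hx
      exact ((hkn w).trans_le (min_le_left _ _)).le
    · rw [hk0 x hx, norm_zero]; exact hε.le
  · change z x + k x = z x
    rw [hk0 x fun h => hx (image_mono (Metric.closedBall_subset_closedBall hr4.le) h),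
      add_zero]
  · refine (hZ.union ((hqfin _ (isCompact_closedBall 0 r)).image j)).subset ?_
    rintro x ⟨hxA, hx0⟩
    change z x + k x = 0 at hx0
    by_cases hx : x ∈ j '' Metric.closedBall 0 r'
    · obtain ⟨w, hw, rfl⟩ := hx
      rw [mem_closedBall_zero_iff] at hw
      rcases le_total ‖w‖ r with h | h
      · right
        refine ⟨w, ⟨by simpa using h, ?_⟩, rfl⟩
        rw [hkj, hχ1 w h, Complex.ofReal_one] at hx0
        linear_combination hx0
      · exfalso
        have h1 := hcf w hxA h hw
        have h2 := (hkn w).trans_le (min_le_right _ _)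
        rw [eq_neg_of_add_eq_zero_left hx0, norm_neg] at h1
        linarith
    · left
      rw [hk0 x hx, add_zero] at hx0
      refine ⟨hxA, fun h => hx (image_mono (Metric.closedBall_subset_closedBall ?_) h), hx0⟩
      linarith

end Charts

section Parity

variable {M : Type*} [TopologicalSpace M]

theorem zero_notMem_segment_of_norm_sub_lt {u v w : ℂ} (hu : ‖u - w‖ < ‖w‖)
    (hv : ‖v - w‖ < ‖w‖) : (0 : ℂ) ∉ segment ℝ u v := by
  intro h
  have hs : segment ℝ u v ⊆ Metric.ball w ‖w‖ :=
    (convex_ball w ‖w‖).segment_subset (by rwa [Metric.mem_ball, dist_eq_norm])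
      (by rwa [Metric.mem_ball, dist_eq_norm])
  have := hs h
  rw [Metric.mem_ball, dist_zero_left] at this
  exact lt_irrefl _ this

theorem oddPts_congr_of_zeros {z : M → ℂ} (hz : Continuous z) {A B : Set M}
    (h : ∀ x, z x = 0 → (x ∈ A ↔ x ∈ B)) : oddPts z A = oddPts z B := by
  ext x
  refine and_congr_left fun hx => h x ?_
  by_contra h0
  exact hx (evenAt_of_ne_zero hz h0)

theorem exists_chart_step [T2Space M] {j : ℂ → M} (hj : IsOpenEmbedding j) {s : M → ℝ}
    (hs : Continuous s) {z w : M → ℂ} (hz : Continuous z) (hw : Continuous w)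
    (hZ : {x | 0 ≤ s x ∧ z x = 0}.Finite) {η : ℝ} (hη : 0 < η)
    (h0 : ∀ x, s x = 0 → ‖z x - w x‖ + η < ‖w x‖) :
    ∃ z' : M → ℂ, Continuous z' ∧ (∀ x, ‖z' x - w x‖ ≤ ‖z x - w x‖ + η) ∧
      (∀ x ∈ j '' Metric.closedBall 0 1, ‖z' x - w x‖ ≤ η) ∧ {x | 0 ≤ s x ∧ z' x = 0}.Finite ∧
      ((oddPts z {x | 0 ≤ s x}).ncard : ZMod 2) = (oddPts z' {x | 0 ≤ s x}).ncard := by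
  obtain ⟨ρ, hρ, hρj, hρ0⟩ := exists_extend_zero hj (isCompact_closedBall (0 : ℂ) 2)
    (h := fun w => max 0 (min 1 (2 - ‖w‖))) (by fun_prop) fun w hw => by
      rw [mem_closedBall_zero_iff, not_le] at hw
      exact max_eq_left ((min_le_right _ _).trans (by linarith))
  have hρm : ∀ x, 0 ≤ ρ x ∧ ρ x ≤ 1 := by
    intro x
    by_cases hx : x ∈ j '' Metric.closedBall 0 2
    · obtain ⟨v, -, rfl⟩ := hx
      rw [hρj]
      exact ⟨le_max_left _ _, max_le zero_le_one (min_le_left _ _)⟩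
    · rw [hρ0 x hx]; exact ⟨le_rfl, zero_le_one⟩
  have hA : IsClosed {x | 0 ≤ s x} := isClosed_le continuous_const hs
  obtain ⟨z', hz', hzz', hoff, hZ'⟩ := exists_perturb_finite_zeros hj hA
    (z := fun x => z x + (ρ x : ℂ) * (w x - z x)) (by fun_prop) (by
      refine hZ.subset ?_
      rintro x ⟨h1, h2, h3⟩
      refine ⟨h1, ?_⟩
      rw [hρ0 x fun h => h2 (image_mono (Metric.closedBall_subset_closedBall (by norm_num)) h)] at h3
      simpa using h3) hη
  have e : ∀ x, z' x - w x =
      (z' x - (z x + (ρ x : ℂ) * (w x - z x))) + ((1 - ρ x : ℝ) : ℂ) * (z x - w x) := by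
    intro x; push_cast; ring
  have hb : ∀ x, ‖z' x - w x‖ ≤ (1 - ρ x) * ‖z x - w x‖ + η := by
    intro x
    rw [e]
    refine (norm_add_le _ _).trans ?_
    rw [norm_mul, Complex.norm_real, Real.norm_of_nonneg (by linarith [(hρm x).2])]
    linarith [hzz' x]
  have hb1 : ∀ x, ‖z' x - w x‖ ≤ ‖z x - w x‖ + η := fun x => by
    nlinarith [hb x, hρm x, norm_nonneg (z x - w x)]
  refine ⟨z', hz', hb1, ?_, hZ', ?_⟩
  · rintro _ ⟨v, hv, rfl⟩
    rw [mem_closedBall_zero_iff] at hv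
    have h1 : ρ (j v) = 1 := by
      rw [hρj, min_eq_left (by linarith)]; simp
    have := hb (j v)
    rw [h1] at this; linarith
  · have hlt : ∀ x, s x = 0 → ‖z x - w x‖ < ‖w x‖ := fun x hx => by linarith [h0 x hx]
    have hlt' : ∀ x, s x = 0 → ‖z' x - w x‖ < ‖w x‖ := fun x hx => by linarith [h0 x hx, hb1 x]
    have hodd : ∀ y : M → ℂ, Continuous y → (∀ x, s x = 0 → ‖y x - w x‖ < ‖w x‖) →
        oddPts y {x | 0 ≤ s x} = oddPts y {x | 0 < s x} := by
      intro y hy hyw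
      refine oddPts_congr_of_zeros hy fun x hx => ⟨fun h => show 0 < s x from lt_of_le_of_ne h fun h' => ?_,
        fun h => (show 0 < s x from h).le⟩
      have := hyw x h'.symm
      rw [hx, zero_sub, norm_neg] at this
      exact lt_irrefl _ this
    rw [hodd z hz hlt, hodd z' hz' hlt']
    refine chart_parity hj (isOpen_lt continuous_const hs) (isCompact_closedBall (0 : ℂ) 4) rfl hz hz'
      (fun x hx => ?_) (hZ.subset fun x hx => ⟨(show 0 < s x from hx.1).le, hx.2⟩)
      (hZ'.subset fun x hx => ⟨(show 0 < s x from hx.1).le, hx.2⟩) ?_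
    · rw [hoff x hx, hρ0 x fun h =>
        hx (image_mono (Metric.closedBall_subset_closedBall (by norm_num)) h)]
      simp
    · have hc : IsCompact (j '' Metric.closedBall 0 4) :=
        (isCompact_closedBall (0 : ℂ) 4).image hj.continuous
      convert hc.inter_right (hA.inter (isClosed_zero_mem_segment hz hz')) using 1
      ext x
      constructor
      · rintro ⟨h1, h2, h3⟩
        exact ⟨h2, (show 0 < s x from h1).le, h3⟩
      · rintro ⟨h1, h2, h3⟩
        refine ⟨show 0 < s x from lt_of_le_of_ne h2 fun h => ?_, h1, h3⟩
        exact zero_notMem_segment_of_norm_sub_lt (hlt x h.symm) (hlt' x h.symm) h3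

/-- `z` is `ε`-close on `K` to a map with finitely many zeros in `{0 ≤ s}`, an odd number of
which have no square root nearby. -/
def OddApprox (s : M → ℝ) (z : M → ℂ) (K : Set M) (ε : ℝ) : Prop :=
  ∃ z' : M → ℂ, Continuous z' ∧ (∀ x ∈ K, ‖z' x - z x‖ ≤ ε) ∧ {x | 0 ≤ s x ∧ z' x = 0}.Finite ∧
    ((oddPts z' {x | 0 ≤ s x}).ncard : ZMod 2) = 1

theorem OddApprox.of_half [T2Space M] {K : Set M} (hK : IsCompact K)
    (hchart : ∀ x ∈ K, ∃ j : ℂ → M, IsOpenEmbedding j ∧ j 0 = x) {s : M → ℝ} (hs : Continuous s)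
    (hsK : ∀ x, 0 ≤ s x → x ∈ K) {w : M → ℂ} (hw : Continuous w) {c : ℝ} (hc : 0 < c)
    (hcw : ∀ x, s x = 0 → c ≤ ‖w x‖) (h : OddApprox s w K (c / 2)) {ε : ℝ} (hε : 0 < ε) :
    OddApprox s w K ε := by
  let Q : Set M → Prop := fun T => ∀ η > 0, ∃ z' : M → ℂ, Continuous z' ∧
    (∀ x ∈ K, ‖z' x - w x‖ ≤ c / 2 + η) ∧ (∀ x ∈ T, ‖z' x - w x‖ ≤ η) ∧
    {x | 0 ≤ s x ∧ z' x = 0}.Finite ∧ ((oddPts z' {x | 0 ≤ s x}).ncard : ZMod 2) = 1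
  have hQ0 : Q ∅ := by
    intro η hη
    obtain ⟨z', h1, h2, h3⟩ := h
    exact ⟨z', h1, fun x hx => by linarith [h2 x hx], fun x hx => hx.elim, h3⟩
  have hQm : ∀ {T T' : Set M}, T ⊆ T' → Q T' → Q T := by
    intro T T' hT hQ η hη
    obtain ⟨z', h1, h2, h3, h4⟩ := hQ η hη
    exact ⟨z', h1, h2, fun x hx => h3 x (hT hx), h4⟩
  have key : ∀ T, Q T → Q (K ∪ T) := by
    refine hK.induction_on (p := fun R => ∀ T, Q T → Q (R ∪ T)) ?_ ?_ ?_ ?_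
    · intro T hT; rwa [empty_union]
    · intro R R' hR h T hT
      exact hQm (union_subset_union_left T hR) (h T hT)
    · intro R R' h h' T hT
      rw [union_assoc]; exact h _ (h' T hT)
    · intro x hx
      obtain ⟨j, hj, rfl⟩ := hchart x hx
      refine ⟨j '' Metric.closedBall 0 1, mem_nhdsWithin_of_mem_nhds
        (hj.isOpenMap.image_mem_nhds (Metric.closedBall_mem_nhds 0 one_pos)), fun T hT η hη => ?_⟩
      obtain ⟨η', hη', h1, h2⟩ : ∃ η' > 0, 2 * η' ≤ η ∧ 8 * η' ≤ c :=
        ⟨min (η / 2) (c / 8), by positivity, by linarith [min_le_left (η / 2) (c / 8)],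
          by linarith [min_le_right (η / 2) (c / 8)]⟩
      obtain ⟨z, hz, hzK, hzT, hZ, hodd⟩ := hT η' hη'
      obtain ⟨z', hz', hb, hb1, hZ', hpar⟩ := exists_chart_step hj hs hz hw hZ hη' fun x hx => by
        linarith [hcw x hx, hzK x (hsK x hx.ge)]
      refine ⟨z', hz', fun x hx => by linarith [hb x, hzK x hx], ?_, hZ', hpar ▸ hodd⟩
      rintro x (hx | hx)
      · linarith [hb1 x hx]
      · linarith [hb x, hzT x hx]
  obtain ⟨z', h1, -, h3, h4⟩ := key ∅ hQ0 ε hε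
  exact ⟨z', h1, fun x hx => h3 x (Or.inl hx), h4⟩

theorem OddApprox.transfer {K : Set M} {s s' : M → ℝ} {z z' : M → ℂ} {c : ℝ}
    (hc : 0 < c) (hsK : ∀ x, 0 ≤ s x → x ∈ K) (hsK' : ∀ x, 0 ≤ s' x → x ∈ K)
    (hzc : ∀ x ∈ K, c ≤ max ‖z x‖ |s x|) (hzc' : ∀ x ∈ K, c ≤ max ‖z' x‖ |s' x|)
    (hzz' : ∀ x ∈ K, ‖z x - z' x‖ ≤ c / 8) (hss' : ∀ x ∈ K, |s x - s' x| ≤ c / 8)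
    (h : OddApprox s z K (c / 8)) : OddApprox s' z' K (c / 2) := by
  obtain ⟨y, hy, hyz, hfin, hodd⟩ := h
  have hkey : ∀ x, y x = 0 → (0 ≤ s x ↔ 0 ≤ s' x) := by
    intro x hx
    by_cases hxK : x ∈ K
    · have h1 := hyz x hxK
      have h2 := hzz' x hxK
      have h3 := abs_le.1 (hss' x hxK)
      rw [hx, zero_sub, norm_neg] at h1
      have h4 : ‖z' x‖ ≤ c / 4 := by
        have := norm_sub_norm_le (z' x) (z x)
        rw [norm_sub_rev] at this
        linarith
      have h5 : c ≤ |s x| := (le_max_iff.1 (hzc x hxK)).resolve_left (by linarith)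
      have h6 : c ≤ |s' x| := (le_max_iff.1 (hzc' x hxK)).resolve_left (by linarith)
      rcases le_abs'.1 h5 with h5 | h5 <;> rcases le_abs'.1 h6 with h6 | h6 <;>
        constructor <;> intro <;> linarith
    · exact ⟨fun h => (hxK (hsK x h)).elim, fun h => (hxK (hsK' x h)).elim⟩
  refine ⟨y, hy, fun x hx => ?_, hfin.subset fun x hx => ⟨(hkey x hx.2).2 hx.1, hx.2⟩, ?_⟩
  · have := norm_sub_le_norm_sub_add_norm_sub (y x) (z x) (z' x)
    linarith [hyz x hx, hzz' x hx]
  · rwa [← oddPts_congr_of_zeros hy (A := {x | 0 ≤ s x}) (B := {x | 0 ≤ s' x}) hkey]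

/-- A homotopy of pairs `(z, s)` never vanishing simultaneously cannot remove an odd number of
zeros of `z` in the region `0 ≤ s`. -/
theorem false_of_odd_zeros_removed [T2Space M] {K : Set M} (hK : IsCompact K)
    (hchart : ∀ x ∈ K, ∃ j : ℂ → M, IsOpenEmbedding j ∧ j 0 = x) {z : M × I → ℂ}
    (hz : Continuous z) {s : M × I → ℝ} (hs : Continuous s) (hsK : ∀ p, 0 ≤ s p → p.1 ∈ K)
    (hzs : ∀ p, z p = 0 → s p ≠ 0) (h0 : ∀ x, 0 ≤ s (x, 0) → z (x, 0) ≠ 0)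
    (hfin : {x | 0 ≤ s (x, 1) ∧ z (x, 1) = 0}.Finite)
    (hodd : ((oddPts (fun x => z (x, 1)) {x | 0 ≤ s (x, 1)}).ncard : ZMod 2) = 1) : False := by
  have hst : ∀ t, Continuous fun x => s (x, t) := fun t => by fun_prop
  have hzt : ∀ t, Continuous fun x => z (x, t) := fun t => by fun_prop
  obtain ⟨c, hc, hcm⟩ := (hK.prod (isCompact_univ (X := I))).exists_forall_le'
    (f := fun p => max ‖z p‖ |s p|) (a := 0) (by fun_prop) fun p _ => by
      by_cases h : z p = 0
      · exact lt_max_of_lt_right (abs_pos.2 (hzs p h))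
      · exact lt_max_of_lt_left (norm_pos_iff.2 h)
  let P : I → Prop := fun t =>
    ∀ ε > 0, OddApprox (fun x => s (x, t)) (fun x => z (x, t)) K ε
  have hP1 : P 1 := fun ε hε => ⟨fun x => z (x, 1), hzt 1, fun x _ => by simpa using hε.le, hfin, hodd⟩
  have hstep : ∀ t t' : I, (∀ x ∈ K, ‖z (x, t) - z (x, t')‖ ≤ c / 8 ∧
      |s (x, t) - s (x, t')| ≤ c / 8) → P t → P t' := by
    intro t t' h hP ε hε
    refine OddApprox.of_half hK hchart (hst t') (fun x hx => hsK _ hx) (hzt t') hc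
      (fun x hx => ?_) ?_ hε
    · have := hcm (x, t') ⟨hsK (x, t') hx.ge, mem_univ _⟩
      have hx' : s (x, t') = 0 := hx
      rw [hx', abs_zero] at this
      exact (le_max_iff.1 this).resolve_right (by linarith)
    · exact OddApprox.transfer hc (fun x hx => hsK _ hx) (fun x hx => hsK _ hx)
        (fun x hx => hcm (x, t) ⟨hx, mem_univ _⟩) (fun x hx => hcm (x, t') ⟨hx, mem_univ _⟩)
        (fun x hx => (h x hx).1) (fun x hx => (h x hx).2) (hP (c / 8) (by positivity))
  have hloc : IsLocallyConstant P := by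
    rw [IsLocallyConstant.iff_eventually_eq]
    intro t
    have hev : ∀ᶠ t' in 𝓝 t, ∀ x ∈ K, ‖z (x, t) - z (x, t')‖ ≤ c / 8 ∧
        |s (x, t) - s (x, t')| ≤ c / 8 := by
      refine hK.eventually_forall_of_forall_eventually fun x _ => ?_
      have h1 : ∀ᶠ p : I × M in 𝓝 (t, x), ‖z (p.2, t) - z (p.2, p.1)‖ < c / 8 := by
        have : Continuous fun p : I × M => ‖z (p.2, t) - z (p.2, p.1)‖ := by fun_prop
        refine this.continuousAt.eventually (Iio_mem_nhds ?_)
        simpa using hc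
      have h2 : ∀ᶠ p : I × M in 𝓝 (t, x), |s (p.2, t) - s (p.2, p.1)| < c / 8 := by
        have : Continuous fun p : I × M => |s (p.2, t) - s (p.2, p.1)| := by fun_prop
        refine this.continuousAt.eventually (Iio_mem_nhds ?_)
        simpa using hc
      filter_upwards [h1, h2] with p hp1 hp2 using ⟨hp1.le, hp2.le⟩
    filter_upwards [hev] with t' ht'
    refine propext ⟨hstep t' t fun x hx => ?_, hstep t t' ht'⟩
    rw [norm_sub_rev, abs_sub_comm]
    exact ht' x hx
  have hP0 : P 0 := by
    rw [hloc.apply_eq_of_isPreconnected isPreconnected_univ (mem_univ 0) (mem_univ 1)]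
    exact hP1
  have hB : IsCompact {x | 0 ≤ s (x, 0)} :=
    hK.of_isClosed_subset (isClosed_le continuous_const (hst 0)) fun x hx => hsK _ hx
  obtain ⟨m, hm, hmz⟩ := hB.exists_forall_le' (f := fun x => ‖z (x, 0)‖) (a := 0)
    (hzt 0).norm.continuousOn fun x hx => norm_pos_iff.2 (h0 x hx)
  obtain ⟨y, hy, hyz, -, hyodd⟩ := hP0 (m / 2) (by positivity)
  have : oddPts y {x | 0 ≤ s (x, 0)} = ∅ := by
    refine eq_empty_of_subset_empty ((oddPts_subset_zeros hy _).trans ?_)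
    rintro x ⟨hx, hx0⟩
    have h1 := hyz x (hsK (x, 0) hx)
    rw [hx0, zero_sub, norm_neg] at h1
    linarith [hmz x hx]
  rw [this] at hyodd
  simp at hyodd

end Parity

theorem exists_nonvanishing_path {f : I → ℂ} (hf : Continuous f) (h0 : f 0 ≠ 0) (h1 : f 1 ≠ 0)
    {ε : ℝ} (hε : 0 < ε) : ∃ f' : I → ℂ, Continuous f' ∧ f' 0 = f 0 ∧ f' 1 = f 1 ∧
      (∀ t, ‖f' t - f t‖ < ε) ∧ ∀ t, f' t ≠ 0 := by
  set c := min ‖f 0‖ ‖f 1‖ with hc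
  have hcpos : 0 < c := lt_min (norm_pos_iff.2 h0) (norm_pos_iff.2 h1)
  obtain ⟨δ, hδ, hδε, hδc⟩ : ∃ δ > 0, δ ≤ ε ∧ δ ≤ c / 2 :=
    ⟨min ε (c / 2), by positivity, min_le_left _ _, min_le_right _ _⟩
  obtain ⟨g, hg, hgf, -⟩ := (hf.comp (continuous_projIcc (h := zero_le_one))).exists_contDiff_approx 1
    (ε := fun _ => δ / 2) continuous_const fun _ => by positivity
  have hdense : Dense (range g)ᶜ := hg.dense_compl_range_of_finrank_lt_finrank (by simp)
  obtain ⟨v, hv, hvg⟩ := hdense.exists_mem_open Metric.isOpen_ball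
    ⟨0, Metric.mem_ball_self (half_pos hδ)⟩
  rw [mem_ball_zero_iff] at hvg
  have hh : ∀ t : I, ‖g t - v - f t‖ < δ := by
    intro t
    have e := hgf t
    rw [dist_eq_norm, Function.comp_apply, projIcc_val] at e
    calc ‖g t - v - f t‖ = ‖(g t - f t) - v‖ := by ring_nf
      _ ≤ ‖g t - f t‖ + ‖v‖ := norm_sub_le _ _
      _ < δ := by linarith
  set χ : I → ℝ := fun t => max 0 (min 1 (2 - 2 * ‖f t‖ / c)) with hχ
  have hχm : ∀ t, 0 ≤ χ t ∧ χ t ≤ 1 := fun t =>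
    ⟨le_max_left _ _, max_le zero_le_one (min_le_left _ _)⟩
  have hχ0 : ∀ t, c ≤ ‖f t‖ → χ t = 0 := by
    intro t ht
    have : 2 - 2 * ‖f t‖ / c ≤ 0 := by
      rw [sub_nonpos, le_div_iff₀ hcpos]; linarith
    exact max_eq_left ((min_le_right _ _).trans this)
  have hχ1 : ∀ t, ‖f t‖ ≤ c / 2 → χ t = 1 := by
    intro t ht
    have : 1 ≤ 2 - 2 * ‖f t‖ / c := by
      have : 2 * ‖f t‖ / c ≤ 1 := by rw [div_le_iff₀ hcpos]; linarith
      linarith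
    simp [hχ, min_eq_left this]
  have hn : ∀ t, ‖(χ t : ℂ) * (g t - v - f t)‖ < δ := by
    intro t
    rw [norm_mul, Complex.norm_real, Real.norm_of_nonneg (hχm t).1]
    nlinarith [hh t, hχm t, norm_nonneg (g t - v - f t)]
  have hχc : Continuous χ := by fun_prop
  have hgc : Continuous g := hg.continuous
  refine ⟨fun t => f t + (χ t : ℂ) * (g t - v - f t), by fun_prop, ?_, ?_, fun t => ?_,
    fun t ht => ?_⟩
  · simp [hχ0 0 (min_le_left _ _)]
  · simp [hχ0 1 (min_le_right _ _)]
  · rw [add_sub_cancel_left]; exact (hn t).trans_le hδε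
  · change f t + (χ t : ℂ) * (g t - v - f t) = 0 at ht
    rcases le_total ‖f t‖ (c / 2) with h | h
    · rw [hχ1 t h, Complex.ofReal_one] at ht
      exact hv ⟨t, by linear_combination ht⟩
    · rw [eq_neg_of_add_eq_zero_left ht, norm_neg] at h
      linarith [hn t]

theorem IsGraph.exists_nonvanishing_approx {Γ : Type*} [TopologicalSpace Γ] (hΓ : IsGraph Γ)
    {a : Γ → ℂ} (ha : Continuous a) {B : Set Γ} (hB : IsCompact B) {ε : ℝ} (hε : 0 < ε) :
    ∃ a' : Γ → ℂ, Continuous a' ∧ (∀ x, ‖a' x - a x‖ < ε) ∧ ∀ x ∈ B, a' x ≠ 0 := by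
  classical
  obtain ⟨V, E, hV, hVd, hend, hemb, hEV, hdisj, hcov, hlf, hcl, hsingle⟩ := hΓ.cell_structure
  have hEB : {e ∈ E | (range e ∩ B).Nonempty}.Finite := by
    refine hB.induction_on (p := fun T => {e ∈ E | (range e ∩ T).Nonempty}.Finite) ?_ ?_ ?_ ?_
    · simp
    · exact fun T T' hT h => h.subset fun e he => ⟨he.1, he.2.mono (inter_subset_inter_right _ hT)⟩
    · intro T T' h h'
      refine (h.union h').subset ?_
      rintro e ⟨he, x, hx, hxT | hxT⟩
      · exact Or.inl ⟨he, x, hx, hxT⟩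
      · exact Or.inr ⟨he, x, hx, hxT⟩
    · intro x _
      obtain ⟨U, hU, hxU, hfin⟩ := hlf x
      exact ⟨U, mem_nhdsWithin_of_mem_nhds (hU.mem_nhds hxU), hfin⟩
  have hVB : (V ∩ B).Finite := by
    refine (hB.inter_left hV).finite ?_
    exact (⟨hVd⟩ : IsDiscrete V).mono inter_subset_left
  have hN : (((fun e : C(I, Γ) => a (e 0)) '' {e ∈ E | (range e ∩ B).Nonempty} ∪
      (fun e : C(I, Γ) => a (e 1)) '' {e ∈ E | (range e ∩ B).Nonempty}) ∪ a '' (V ∩ B)).Finite :=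
    ((hEB.image _).union (hEB.image _)).union (hVB.image _)
  obtain ⟨c, hcN, hc⟩ := (hN.countable.dense_compl ℝ).exists_mem_open Metric.isOpen_ball
    ⟨(0 : ℂ), Metric.mem_ball_self (half_pos hε)⟩
  rw [mem_ball_zero_iff] at hc
  simp only [mem_compl_iff, mem_union, not_or] at hcN
  set b : Γ → ℂ := fun x => a x - c with hb
  have hbc : Continuous b := ha.sub continuous_const
  have hpath : ∀ e : C(I, Γ), ∃ f : I → ℂ, Continuous f ∧ f 0 = b (e 0) ∧ f 1 = b (e 1) ∧
      (∀ t, ‖f t - b (e t)‖ < ε / 2) ∧ (b (e 0) ≠ 0 → b (e 1) ≠ 0 → ∀ t, f t ≠ 0) := by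
    intro e
    by_cases h : b (e 0) ≠ 0 ∧ b (e 1) ≠ 0
    · obtain ⟨f, h1, h2, h3, h4, h5⟩ :=
        exists_nonvanishing_path (hbc.comp e.continuous) h.1 h.2 (half_pos hε)
      exact ⟨f, h1, h2, h3, h4, fun _ _ => h5⟩
    · exact ⟨b ∘ e, hbc.comp e.continuous, rfl, rfl, fun t => by simpa using hε,
        fun h1 h2 => (h ⟨h1, h2⟩).elim⟩
  choose f hfc hf0 hf1 hfb hfn using hpath
  have hcases : ∀ t : I, t ∈ edgeInt ∨ t = 0 ∨ t = 1 := by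
    intro t
    by_cases h0 : t = 0
    · exact Or.inr (Or.inl h0)
    by_cases h1 : t = 1
    · exact Or.inr (Or.inr h1)
    · exact Or.inl ⟨unitInterval.pos_iff_ne_zero.2 h0, unitInterval.lt_one_iff_ne_one.2 h1⟩
  have hendV : ∀ e ∈ E, ∀ t, t ∉ edgeInt → e t ∈ V ∧ f e t = b (e t) := by
    intro e he t ht
    rcases hcases t with h | rfl | rfl
    · exact (ht h).elim
    · exact ⟨(hend e he).1, hf0 e⟩
    · exact ⟨(hend e he).2, hf1 e⟩
  have hintV : ∀ e ∈ E, ∀ t ∈ edgeInt, e t ∉ V := fun e he t ht h => by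
    have : e t ∈ (e '' edgeInt) ∩ V := ⟨⟨t, ht, rfl⟩, h⟩
    rw [hEV e he] at this
    exact this
  have hex : ∀ x, ∃ y : ℂ, (x ∈ V → y = b x) ∧ ∀ e ∈ E, ∀ t, e t = x → y = f e t := by
    intro x
    by_cases hx : x ∈ V
    · refine ⟨b x, fun _ => rfl, ?_⟩
      rintro e he t rfl
      exact (hendV e he t fun ht => hintV e he t ht hx).2.symm
    · have : x ∈ V ∪ ⋃ e ∈ E, e '' edgeInt := hcov ▸ mem_univ x
      obtain ⟨e₀, he₀, t₀, ht₀, rfl⟩ : ∃ e ∈ E, ∃ t ∈ edgeInt, e t = x := by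
        simpa [hx] using this
      refine ⟨f e₀ t₀, fun h => (hx h).elim, fun e he t hte => ?_⟩
      have ht : t ∈ edgeInt := by
        by_contra h
        exact hx (hte ▸ (hendV e he t h).1)
      have hee : e = e₀ := by
        by_contra h
        have h2 : e₀ t₀ ∈ (e '' edgeInt) ∩ (e₀ '' edgeInt) := ⟨⟨t, ht, hte⟩, t₀, ht₀, rfl⟩
        rw [hdisj e he e₀ he₀ h] at h2
        exact h2
      subst hee
      have := (hemb e he).injective (a₁ := ⟨t, ht⟩) (a₂ := ⟨t₀, ht₀⟩) hte
      rw [Subtype.mk.inj this]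
  choose a' ha'V ha'E using hex
  have hclose : ∀ x, ‖a' x - b x‖ < ε / 2 := by
    intro x
    by_cases hx : x ∈ V
    · rw [ha'V x hx, sub_self, norm_zero]; exact half_pos hε
    · have : x ∈ V ∪ ⋃ e ∈ E, e '' edgeInt := hcov ▸ mem_univ x
      obtain ⟨e, he, t, -, rfl⟩ : ∃ e ∈ E, ∃ t ∈ edgeInt, e t = x := by
        simpa [hx] using this
      rw [ha'E _ e he t rfl]
      exact hfb e t
  refine ⟨a', ?_, fun x => ?_, fun x hx => ?_⟩
  · by_cases hs : ∃ v, (univ : Set Γ) = {v}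
    · obtain ⟨v, hv⟩ := hs
      have : Subsingleton Γ := subsingleton_univ_iff.1 (hv ▸ subsingleton_singleton)
      exact continuous_of_const fun x y => by rw [Subsingleton.elim x y]
    · have hun : ⋃ e ∈ E, range e = univ := by
        refine eq_univ_of_forall fun x => ?_
        by_cases hx : x ∈ V
        · obtain ⟨e, he, h⟩ := (hsingle x hx).resolve_right fun h => hs ⟨x, h⟩
          exact mem_biUnion he h
        · have : x ∈ V ∪ ⋃ e ∈ E, e '' edgeInt := hcov ▸ mem_univ x
          obtain ⟨e, he, t, -, rfl⟩ : ∃ e ∈ E, ∃ t ∈ edgeInt, e t = x := by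
            simpa [hx] using this
          exact mem_biUnion he ⟨t, rfl⟩
      refine continuous_iff_isClosed.2 fun C hC => ?_
      have := hcl (a' ⁻¹' C) fun e he => by
        have : e ⁻¹' (a' ⁻¹' C) = f e ⁻¹' C := by
          ext t
          rw [mem_preimage, mem_preimage, ha'E _ e he t rfl, mem_preimage]
        rw [this]
        exact hC.preimage (hfc e)
      rwa [hun, inter_univ] at this
  · have := norm_sub_le_norm_sub_add_norm_sub (a' x) (b x) (a x)
    have h2 : ‖b x - a x‖ = ‖c‖ := by rw [hb]; simp
    linarith [hclose x]
  · by_cases hxV : x ∈ V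
    · rw [ha'V x hxV]
      exact sub_ne_zero.2 fun h => hcN.2 ⟨x, ⟨hxV, hx⟩, h⟩
    · have : x ∈ V ∪ ⋃ e ∈ E, e '' edgeInt := hcov ▸ mem_univ x
      obtain ⟨e, he, t, -, rfl⟩ : ∃ e ∈ E, ∃ t ∈ edgeInt, e t = x := by
        simpa [hxV] using this
      have heB : e ∈ {e ∈ E | (range e ∩ B).Nonempty} := ⟨he, e t, ⟨t, rfl⟩, hx⟩
      rw [ha'E _ e he t rfl]
      exact hfn e (sub_ne_zero.2 fun h => hcN.1.1 ⟨e, heB, h⟩)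
        (sub_ne_zero.2 fun h => hcN.1.2 ⟨e, heB, h⟩) t

theorem exists_plane_chart_of_notMem_bd {S : Type*} [TopologicalSpace S] {x : S} (hx : x ∉ Bd S)
    {O : Set S} (hO : IsOpen O) (hxO : x ∈ O) :
    ∃ j : ℂ → S, IsOpenEmbedding j ∧ j 0 = x ∧ range j ⊆ O := by
  obtain ⟨U, hU, hxU, ⟨e⟩⟩ := not_not.1 hx
  let i : ℂ → S := fun w => e.symm (Complex.equivRealProdCLM w)
  have hi : IsOpenEmbedding i := hU.isOpenEmbedding_subtypeVal.comp
    (e.symm.isOpenEmbedding.comp Complex.equivRealProdCLM.toHomeomorph.isOpenEmbedding)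
  set p : ℂ := Complex.equivRealProdCLM.symm (e ⟨x, hxU⟩) with hp
  have hip : i p = x := by simp [i, hp]
  obtain ⟨r, hr, hball⟩ := Metric.isOpen_iff.1 (hO.preimage hi.continuous) p (by simpa [hip])
  refine ⟨i ∘ OpenPartialHomeomorph.univBall p r,
    hi.comp ((OpenPartialHomeomorph.univBall p r).isOpenEmbedding
      (OpenPartialHomeomorph.univBall_source p r)), by simp [hip], ?_⟩
  rintro _ ⟨w, rfl⟩
  refine hball ?_
  rw [← OpenPartialHomeomorph.univBall_target p hr]
  exact (OpenPartialHomeomorph.univBall p r).map_source (by simp)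

theorem hasLogOrder_mul_two_sub_norm :
    HasLogOrder (fun w => w * ((max 0 (2 - ‖w‖) : ℝ) : ℂ)) 0 1 := by
  refine ⟨1, one_pos, fun w => ((Real.log (2 - ‖w‖) : ℝ) : ℂ), ?_, ?_⟩
  · refine Complex.continuous_ofReal.comp_continuousOn (ContinuousOn.log (by fun_prop) ?_)
    rintro w ⟨hw, -⟩
    rw [mem_ball_zero_iff] at hw
    linarith
  · rintro w ⟨hw, -⟩
    rw [mem_ball_zero_iff] at hw
    have h1 : 0 < 2 - ‖w‖ := by linarith
    change w * ((max 0 (2 - ‖w‖) : ℝ) : ℂ) = _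
    rw [sub_zero, zpow_one, ← Complex.ofReal_exp, Real.exp_log h1, max_eq_right h1.le]

theorem IsSurface.component_inter_bd_nonempty {S Γ : Type*} [TopologicalSpace S] [TopologicalSpace Γ]
    (hS : IsSurface S) (hΓ : IsGraph Γ) {φ : S → Γ} {ψ : Γ → S} (hφψ : IsPHEPair φ ψ)
    {L : Set S} (hL : IsCompact L) (x : S)
    (hU : ∀ Q : Set S, IsCompact Q → ¬ connectedComponentIn Lᶜ x ⊆ Q) :
    (connectedComponentIn Lᶜ x ∩ Bd S).Nonempty := by
  have := hS.t2
  have := hS.locallyConnectedSpace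
  by_contra hne
  set U := connectedComponentIn Lᶜ x with hUdef
  have hUB : ∀ y ∈ U, y ∉ Bd S := fun y hy hyB => hne ⟨y, hy, hyB⟩
  have hUo : IsOpen U := hL.isClosed.isOpen_compl.connectedComponentIn
  obtain ⟨⟨hφ, -⟩, ⟨hψ, hψp⟩, ⟨H, ⟨hH, hHp⟩, hH0, hH1⟩, -⟩ := hφψ
  set L₁ := Prod.fst '' (H ⁻¹' L) with hL₁
  have hL₁c : IsCompact L₁ := (hHp L hL).image continuous_fst
  set L₂ := H '' (L₁ ×ˢ univ) ∪ L with hL₂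
  have hL₂c : IsCompact L₂ := ((hL₁c.prod isCompact_univ).image hH).union hL
  obtain ⟨u, huU, huL⟩ := not_subset.1 (hU L₂ hL₂c)
  obtain ⟨j, hj, hj0, hjr⟩ := exists_plane_chart_of_notMem_bd (hUB u huU)
    (hUo.inter hL₂c.isClosed.isOpen_compl) ⟨huU, huL⟩
  have htrack : ∀ p : S × I, H p ∈ range j → p.1 ∈ U := by
    rintro ⟨y, t⟩ hp
    obtain ⟨hpU, hpL⟩ := hjr hp
    have hy : y ∉ L₁ := fun h => hpL (Or.inl ⟨(y, t), ⟨h, mem_univ _⟩, rfl⟩)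
    have hpre : IsPreconnected (range fun τ : I => H (y, τ)) := isPreconnected_range (by fun_prop)
    have hsub : (range fun τ : I => H (y, τ)) ⊆ Lᶜ := by
      rintro _ ⟨τ, rfl⟩ h
      exact hy ⟨(y, τ), h, rfl⟩
    have := hpre.subset_connectedComponentIn ⟨t, rfl⟩ hsub
    rw [hUdef, connectedComponentIn_eq hpU]
    exact this ⟨1, hH1 y⟩
  have hmem0 : ∀ w ∉ Metric.closedBall (0 : ℂ) 2, max 0 (2 - ‖w‖) = 0 := by
    intro w hw
    rw [mem_closedBall_zero_iff, not_le] at hw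
    exact max_eq_left (by linarith)
  have hD := isCompact_closedBall (0 : ℂ) 2
  obtain ⟨z, hz, hzj, -⟩ := exists_extend_zero hj hD
    (h := fun w => w * ((max 0 (2 - ‖w‖) : ℝ) : ℂ)) (by fun_prop) fun w hw => by
      simp [hmem0 w hw]
  obtain ⟨s, hs, hsj, hs0⟩ := exists_extend_zero hj hD
    (h := fun w => max 0 (2 - ‖w‖)) (by fun_prop) hmem0
  have hsD : ∀ q, 0 ≤ s q - 1 → q ∈ j '' Metric.closedBall 0 2 := by
    intro q hq
    by_contra h
    rw [hs0 q h] at hq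
    linarith
  have hs1 : ∀ q, s q - 1 = 0 → ‖z q‖ = 1 := by
    intro q hq
    obtain ⟨w, -, rfl⟩ := hsD q hq.ge
    rw [hsj, sub_eq_zero] at hq
    have : ‖w‖ = 1 := by
      rcases le_total (2 - ‖w‖) 0 with h | h
      · rw [max_eq_left h] at hq; linarith
      · rw [max_eq_right h] at hq; linarith
    rw [hzj, hq, norm_mul, this]; simp
  have hDc : IsCompact (j '' Metric.closedBall 0 2) := hD.image hj.continuous
  obtain ⟨a, ha, haz, ha0⟩ := hΓ.exists_nonvanishing_approx (hz.comp hψ) (hψp _ hDc) one_pos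
  have hzero : {y | 0 ≤ s y - 1 ∧ z y = 0} = {u} := by
    ext y
    constructor
    · rintro ⟨h1, h2⟩
      obtain ⟨w, -, rfl⟩ := hsD y h1
      rw [hsj] at h1
      rw [hzj, mul_eq_zero] at h2
      rcases h2 with rfl | h2
      · exact hj0
      · rw [Complex.ofReal_eq_zero] at h2
        linarith
    · rintro rfl
      rw [← hj0]
      refine ⟨?_, ?_⟩
      · rw [hsj]; norm_num
      · rw [hzj]; simp
  refine false_of_odd_zeros_removed (K := Prod.fst '' (H ⁻¹' (j '' Metric.closedBall 0 2)))
    ((hHp _ hDc).image continuous_fst) ?_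
    (z := fun p => z (H p) + ((1 - p.2 : ℝ) : ℂ) * (a (φ p.1) - z (ψ (φ p.1))))
    (by fun_prop) (s := fun p => s (H p) - 1) (by fun_prop) ?_ ?_ ?_ ?_ ?_
  · rintro _ ⟨p, hp, rfl⟩
    obtain ⟨i, hi, hi0, -⟩ := exists_plane_chart_of_notMem_bd
      (hUB _ (htrack p (image_subset_range _ _ hp))) isOpen_univ (mem_univ _)
    exact ⟨i, hi, hi0⟩
  · exact fun p hp => ⟨p, hsD _ hp, rfl⟩
  · intro p hp0 hps
    have h1 := hs1 _ hps
    rw [eq_neg_of_add_eq_zero_left hp0, norm_neg, norm_mul, Complex.norm_real,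
      Real.norm_of_nonneg (sub_nonneg.2 p.2.2.2)] at h1
    have h2 := haz (φ p.1)
    have h3 := p.2.2.1
    simp only [Function.comp_apply] at h2
    nlinarith [norm_nonneg (a (φ p.1) - z (ψ (φ p.1)))]
  · intro y hy
    simp only [hH0, Function.comp_apply] at hy ⊢
    simpa using ha0 (φ y) (hsD _ hy)
  · simp only [hH1]
    refine (finite_singleton u).subset (Subset.trans ?_ hzero.subset)
    rintro y ⟨h1, h2⟩
    exact ⟨h1, by simpa using h2⟩
  · have hev : ¬ EvenAt z u := by
      rw [← hj0, ← evenAt_comp_iff hj]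
      have : z ∘ j = fun w => w * ((max 0 (2 - ‖w‖) : ℝ) : ℂ) := funext hzj
      rw [this, hasLogOrder_mul_two_sub_norm.evenAt_iff]
      decide
    have : oddPts z {y | 0 ≤ s y - 1} = {u} := by
      refine Subset.antisymm ((oddPts_subset_zeros hz _).trans hzero.subset) ?_
      rintro _ rfl
      exact ⟨(hzero.symm.subset rfl).1, hev⟩
    simpa [hH1] using congrArg (fun T : Set S => (T.ncard : ZMod 2)) this

section Ends

variable {S Γ : Type*} [TopologicalSpace S] [TopologicalSpace Γ]

/-- Outside a large compact set, a map properly homotopic to the identity preserves the components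
of the complement of a given compact set. -/
theorem PHtpc.exists_compact_mem_component [T2Space Γ] {r : Γ → Γ} (hr : PHtpc r id) {K : Set Γ}
    (hK : IsCompact K) :
    ∃ C : Set Γ, IsCompact C ∧ ∀ x ∉ C, r x ∈ connectedComponentIn Kᶜ x := by
  obtain ⟨H, hH, h0, h1⟩ := hr
  refine ⟨_, (hH.2 K hK).image continuous_fst, fun x hx => ?_⟩
  have hsub : (fun t => H (x, t)) '' univ ⊆ Kᶜ := by
    rintro _ ⟨t, -, rfl⟩ hK
    exact hx ⟨(x, t), hK, rfl⟩
  have hc : IsPreconnected ((fun t => H (x, t)) '' univ) :=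
    isPreconnected_univ.image _ (hH.1.comp (by fun_prop)).continuousOn
  exact hc.subset_connectedComponentIn ⟨1, mem_univ _, by simp [h1]⟩ hsub
    ⟨0, mem_univ _, by simp [h0]⟩

theorem inducesIdOnEnds_of_isHomeomorph (hS : IsSurface S) (hΓ : IsGraph Γ) {φ : S → Γ}
    {ψ : Γ → S} (hφψ : IsPHEPair φ ψ) {f : S → S} (hf : IsHomeomorph f)
    (hfix : ∀ x ∈ Bd S, f x = x) : InducesIdOnEnds (φ ∘ f ∘ ψ) := by
  have := hS.t2
  have := hΓ.t2
  intro s hs K hK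
  have hφ := hφψ.1
  have hψ := hφψ.2.1
  obtain ⟨C, hC, hCr⟩ := hφψ.2.2.2.exists_compact_mem_component hK
  set L : Set S := φ ⁻¹' K ∪ f ⁻¹' (φ ⁻¹' K)
  have hL : IsCompact L := (hφ.2 K hK).union (hf.properCont.2 _ (hφ.2 K hK))
  set K' : Set Γ := K ∪ C ∪ ψ ⁻¹' L
  have hK' : IsCompact K' := (hK.union hC).union (hψ.2 L hL)
  have hKK' : K ⊆ K' := subset_union_left.trans subset_union_left
  refine ⟨K', hK', hKK', ?_⟩
  have key : ∀ K : Set Γ, IsCompact K → s K ⊆ Kᶜ ∧ (s K).Nonempty ∧ IsPreconnected (s K) := by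
    intro K hK
    obtain ⟨x, hx, h⟩ := hs.1 K hK
    rw [h]
    exact ⟨connectedComponentIn_subset _ _, ⟨x, mem_connectedComponentIn hx⟩,
      isPreconnected_connectedComponentIn⟩
  obtain ⟨hsub, ⟨x, hx⟩, hconn⟩ := key K' hK'
  have hxs : ∀ y ∈ s K', s K = connectedComponentIn Kᶜ y := by
    intro y hy
    obtain ⟨z, hz, h⟩ := hs.1 K hK
    have := hs.2 K K' hK hK' hKK' hy
    rw [h] at this ⊢
    exact connectedComponentIn_eq this
  have hψsub : ψ '' s K' ⊆ Lᶜ := by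
    rintro _ ⟨y, hy, rfl⟩ hyL
    exact hsub hy (Or.inr hyL)
  set U := connectedComponentIn Lᶜ (ψ x)
  have hUsub : ψ '' s K' ⊆ U :=
    (hconn.image _ hψ.1.continuousOn).subset_connectedComponentIn ⟨x, hx, rfl⟩ hψsub
  have hUnc : ∀ Q : Set S, IsCompact Q → ¬ U ⊆ Q := by
    intro Q hQ hUQ
    have hQ' := hψ.2 Q hQ
    obtain ⟨h1, ⟨y, hy⟩, -⟩ := key _ (hK'.union hQ')
    refine h1 hy (Or.inr (hUQ (hUsub ⟨y, ?_, rfl⟩)))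
    exact hs.2 _ _ hK' (hK'.union hQ') subset_union_left hy
  obtain ⟨b, hbU, hb⟩ := hS.component_inter_bd_nonempty hΓ hφψ hL (ψ x) hUnc
  have hUL : U ⊆ Lᶜ := connectedComponentIn_subset _ _
  have hUc : IsPreconnected U := isPreconnected_connectedComponentIn
  have h1 : φ '' U ⊆ connectedComponentIn Kᶜ (φ b) := by
    refine (hUc.image _ hφ.1.continuousOn).subset_connectedComponentIn ⟨b, hbU, rfl⟩ ?_
    rintro _ ⟨y, hy, rfl⟩ hyK
    exact hUL hy (Or.inl hyK)
  have h2 : (φ ∘ f) '' U ⊆ connectedComponentIn Kᶜ (φ b) := by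
    refine (hUc.image _ (hφ.1.comp hf.continuous).continuousOn).subset_connectedComponentIn
      ⟨b, hbU, by simp [hfix b hb]⟩ ?_
    rintro _ ⟨y, hy, rfl⟩ hyK
    exact hUL hy (Or.inr hyK)
  have h3 : φ (ψ x) ∈ s K := by
    rw [hxs x hx]
    exact hCr x fun hxC => hsub hx (Or.inl (Or.inr hxC))
  have h4 : s K = connectedComponentIn Kᶜ (φ b) := by
    obtain ⟨z, hz, h⟩ := hs.1 K hK
    rw [h] at h3 ⊢
    rw [connectedComponentIn_eq h3,
      connectedComponentIn_eq (h1 ⟨ψ x, hUsub ⟨x, hx, rfl⟩, rfl⟩)]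
  rintro _ ⟨y, hy, rfl⟩
  rw [h4]
  exact h2 ⟨ψ y, hUsub ⟨y, hy, rfl⟩, rfl⟩

end Ends

/-- Let `S` be a surface properly homotopy equivalent to a graph `Γ`, via a
proper homotopy equivalence `φ : S → Γ` with proper homotopy inverse `ψ`. Then
`Θ([f]) = [φ∘f∘ψ]` is a well-defined group homomorphism `Map(S) → Map(Γ)` whose image is
contained in the pure mapping class group `PMap(Γ)`. (Stated on representatives:
well-definedness, landing in `Map(Γ)`, multiplicativity, and pureness of the image.) -/
theorem induced_map_wellDefined_hom_pure (S : Type*) [TopologicalSpace S]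
    (Γ : Type*) [TopologicalSpace Γ] (hS : IsSurface S) (hΓ : IsGraph Γ)
    (φ : S → Γ) (ψ : Γ → S) (hφψ : IsPHEPair φ ψ) :
    (∀ f g : S → S, IsHomeomorph f → IsHomeomorph g → (∀ x ∈ Bd S, f x = x) →
      (∀ x ∈ Bd S, g x = x) → IsotopicRel (Bd S) f g →
      PHtpc (φ ∘ f ∘ ψ) (φ ∘ g ∘ ψ)) ∧
    (∀ f : S → S, IsHomeomorph f → (∀ x ∈ Bd S, f x = x) → IsPHE (φ ∘ f ∘ ψ)) ∧
    (∀ f g : S → S, IsHomeomorph f → IsHomeomorph g → (∀ x ∈ Bd S, f x = x) →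
      (∀ x ∈ Bd S, g x = x) →
      PHtpc (φ ∘ (f ∘ g) ∘ ψ) ((φ ∘ f ∘ ψ) ∘ (φ ∘ g ∘ ψ))) ∧
    (∀ f : S → S, IsHomeomorph f → (∀ x ∈ Bd S, f x = x) →
      InducesIdOnEnds (φ ∘ f ∘ ψ)) := by
  have := hS.t2
  have := hΓ.t2
  have := hS.locallyCompactSpace
  have := hS.locallyConnectedSpace
  have hφ := hφψ.1
  have hψ := hφψ.2.1
  have hmul : ∀ f g : S → S, ProperCont f → ProperCont g →
      PHtpc (φ ∘ (f ∘ g) ∘ ψ) ((φ ∘ f ∘ ψ) ∘ (φ ∘ g ∘ ψ)) := fun f g hf hg =>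
    ((hφψ.2.2.1.comp_right (hg.comp hψ)).comp_left (hφ.comp hf)).symm
  refine ⟨?_, ?_, ?_, ?_⟩
  · rintro f g - - - - ⟨H, hH, h0, h1, hiso⟩
    have hp : PHtpc f g := ⟨H, properCont_of_isotopy hH fun t => (hiso t).1, h0, h1⟩
    exact (hp.comp_right hψ).comp_left hφ
  · intro f hf _
    let e := hf.homeomorph f
    have hf' : ProperCont e := hf.properCont
    have hg' : ProperCont e.symm := e.symm.isHomeomorph.properCont
    refine ⟨φ ∘ e.symm ∘ ψ, hφ.comp (hf'.comp hψ), hφ.comp (hg'.comp hψ), ?_, ?_⟩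
    · refine (hmul e.symm e hg' hf').symm.trans ?_
      have : φ ∘ (e.symm ∘ e) ∘ ψ = φ ∘ ψ := by simp
      rw [this]
      exact hφψ.2.2.2
    · refine (hmul e e.symm hf' hg').symm.trans ?_
      have : φ ∘ (e ∘ e.symm) ∘ ψ = φ ∘ ψ := by simp
      rw [this]
      exact hφψ.2.2.2
  · intro f g hf hg _ _
    exact hmul f g hf.properCont hg.properCont
  · intro f hf hfix
    exact inducesIdOnEnds_of_isHomeomorph hS hΓ hφψ hf hfix
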